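/- Let 𝔻 ⊂ ℝ² be the open unit disk, α > -1, p > 1, and K ∈ C¹(𝔻̄) with K > 0 on 𝔻̄. Suppose u ∈ C(𝔻̄) ∩ C²(𝔻 ∖ {0}) satisfies -Δu = |y|^{2α} K(y) u^{p} pointwise on 𝔻 ∖ {0}, u > 0 in 𝔻, u = 0 on ∂𝔻, and suppose moreover that sup_𝔻 u ≤ C₀ for some constant C₀ > 0. Then p ∫_𝔻 |y|^{2α} K(y) u(y)^{p+1} dy ≤ 8π C₀² ( 2(1+α) + (sup_{y∈𝔻} |∇K(y)|)/(inf_{y∈𝔻} K(y)) ). -/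

import Mathlib

open MeasureTheory Real Set Metric

noncomputable section

abbrev Plane := EuclideanSpace ℝ (Fin 2)

/-- The Laplace operator on ℝ² (acting on real-valued functions). -/
def lap (u : Plane → ℝ) (x : Plane) : ℝ :=
  ∑ i, fderiv ℝ (fun y => fderiv ℝ u y (EuclideanSpace.single i 1)) x
    (EuclideanSpace.single i 1)

/-- `Ω` has smooth boundary: near each boundary point, `Ω` is a sublevel set of a smooth
function with nonvanishing differential, whose zero set is the boundary. -/
def SmoothBoundary (Ω : Set Plane) : Prop :=
  ∀ x ∈ frontier Ω, ∃ (U : Set Plane) (f : Plane → ℝ),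
    IsOpen U ∧ x ∈ U ∧ ContDiffOn ℝ (⊤ : ℕ∞) f U ∧
    (∀ y ∈ U, fderiv ℝ f y ≠ 0) ∧
    Ω ∩ U = {y ∈ U | f y < 0} ∧ frontier Ω ∩ U = {y ∈ U | f y = 0}

/-- A function with nonpositive derivative on `(-∞, T)` is nonincreasing there. -/
theorem antitoneOn_Iio_of_hasDerivAt {f f' : ℝ → ℝ} {T : ℝ}
    (hf : ∀ t < T, HasDerivAt f (f' t) t) (hf' : ∀ t < T, f' t ≤ 0) : AntitoneOn f (Iio T) := by
  refine antitoneOn_of_deriv_nonpos (convex_Iio T)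
    (fun t ht => (hf t ht).continuousAt.continuousWithinAt) ?_ ?_
  · rw [interior_Iio]
    exact fun t ht => (hf t ht).differentiableAt.differentiableWithinAt
  · rw [interior_Iio]
    intro t ht
    rw [(hf t ht).deriv]
    exact hf' t ht

/-- A function whose derivative is at most `-δ < 0` near `-∞` is not bounded above. -/
theorem exists_lt_of_hasDerivAt_le_neg {f f' : ℝ → ℝ} {T δ : ℝ} (B : ℝ) (hδ : 0 < δ)
    (hf : ∀ t < T, HasDerivAt f (f' t) t) (hf' : ∀ t < T, f' t ≤ -δ) : ∃ t < T, B < f t := by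
  have hanti : AntitoneOn (fun t => f t + δ * t) (Iio T) :=
    antitoneOn_Iio_of_hasDerivAt (f' := fun t => f' t + δ * 1)
      (fun t ht => (hf t ht).add ((hasDerivAt_id t).const_mul δ))
      (fun t ht => by linarith [hf' t ht])
  set a : ℝ := |B - f (T - 1)| + 1
  have ha : 0 < a := by positivity
  have hs : T - 1 - a / δ < T := by
    have : 0 < a / δ := by positivity
    linarith
  refine ⟨T - 1 - a / δ, hs, ?_⟩
  have h := hanti (a := T - 1 - a / δ) (b := T - 1) hs (by simp)
    (by have : 0 < a / δ := by positivity
        linarith)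
  have h2 : δ * (a / δ) = a := by field_simp
  have h3 : B - f (T - 1) < a := by
    have := le_abs_self (B - f (T - 1))
    simp only [a]; linarith
  simp only at h
  nlinarith

/-- A function with second derivative at least `δ > 0` near `-∞` is not bounded above. -/
theorem exists_lt_of_second_deriv_ge {f f' f'' : ℝ → ℝ} {T δ : ℝ} (B : ℝ) (hδ : 0 < δ)
    (hf : ∀ t < T, HasDerivAt f (f' t) t) (hf' : ∀ t < T, HasDerivAt f' (f'' t) t)
    (hf'' : ∀ t < T, δ ≤ f'' t) : ∃ t < T, B < f t := by
  obtain ⟨s, hs, hs1⟩ := exists_lt_of_hasDerivAt_le_neg (f := fun t => -f' t)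
    (f' := fun t => -f'' t) 1 hδ (fun t ht => (hf' t ht).neg)
    (fun t ht => by linarith [hf'' t ht])
  have hanti := antitoneOn_Iio_of_hasDerivAt (f := fun t => -f' t)
    (f' := fun t => -f'' t) (fun t ht => (hf' t ht).neg)
    (fun t ht => by linarith [hf'' t ht])
  obtain ⟨t, ht, h⟩ := exists_lt_of_hasDerivAt_le_neg (f := f) (f' := f') (T := s) B one_pos
    (fun t ht => hf t (ht.trans hs))
    (fun t ht => by
      have := hanti (ht.trans hs) hs ht.le
      simp only at this
      linarith)
  exact ⟨t, ht.trans hs, h⟩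

/-- One-sided maximum principle for `c'' = κ c - g` on `(-∞, 0)` with zero boundary values. -/
theorem le_div_of_second_deriv_eq {c c' c'' : ℝ → ℝ} {κ G : ℝ} (hκ : 0 < κ) (hG : 0 ≤ G)
    (hc : ∀ t < 0, HasDerivAt c (c' t) t) (hc' : ∀ t < 0, HasDerivAt c' (c'' t) t)
    (hc'' : ∀ t < 0, κ * c t - G ≤ c'' t)
    (h0 : ∀ ε > 0, ∃ δ < 0, ∀ t, δ < t → t < 0 → c t ≤ ε)
    (hbot : ∀ ε > 0, ∃ T < 0, ∀ t < T, c t ≤ ε) {t : ℝ} (ht : t < 0) : c t ≤ G / κ := by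
  by_contra! hlt
  have hGκ : 0 ≤ G / κ := by positivity
  have hpos : 0 < c t := hGκ.trans_lt hlt
  obtain ⟨δ, hδ, hδc⟩ := h0 (c t / 2) (by positivity)
  obtain ⟨T, hT, hTc⟩ := hbot (c t / 2) (by positivity)
  have htδ : t ≤ δ := by
    by_contra! h
    linarith [hδc t h ht]
  have hTt : T ≤ t := by
    by_contra! h
    linarith [hTc t h]
  have hneg : ∀ x ∈ Icc T δ, x < 0 := fun x hx => hx.2.trans_lt hδ
  obtain ⟨z, hz, hzmax⟩ := isCompact_Icc.exists_isMaxOn (⟨t, hTt, htδ⟩ : (Icc T δ).Nonempty)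
    (f := c) (fun x hx => (hc x (hneg x hx)).continuousAt.continuousWithinAt)
  have hz0 : z < 0 := hneg z hz
  have htz : c t ≤ c z := hzmax ⟨hTt, htδ⟩
  have hmax : IsLocalMax c z := by
    filter_upwards [Iio_mem_nhds hz0] with x hx
    by_cases h1 : x < T
    · linarith [hTc x h1]
    by_cases h2 : δ < x
    · linarith [hδc x h2 hx]
    exact hzmax ⟨not_lt.1 h1, not_lt.1 h2⟩
  have hderiv : deriv c =ᶠ[nhds z] c' := by
    filter_upwards [Iio_mem_nhds hz0] with x hx using (hc x hx).deriv
  have hpos2 : 0 < c'' z := by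
    have : G < κ * c z := by
      have := (div_lt_iff₀ hκ).1 (hlt.trans_le htz)
      linarith
    linarith [hc'' z hz0]
  have hmin : IsLocalMin c z := by
    refine isLocalMin_of_deriv_deriv_pos ?_ hmax.deriv_eq_zero (hc z hz0).continuousAt
    rw [hderiv.deriv_eq, (hc' z hz0).deriv]
    exact hpos2
  have hconst : c =ᶠ[nhds z] fun _ => c z := by
    filter_upwards [hmax, hmin] with x h1 h2 using le_antisymm h1 h2
  have h1 : deriv (deriv c) z = 0 := by
    have h2 : deriv c =ᶠ[nhds z] fun _ => 0 := by
      filter_upwards [hconst.eventuallyEq_nhds] with x hx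
      rw [hx.deriv_eq]; simp
    rw [h2.deriv_eq]; simp
  rw [hderiv.deriv_eq, (hc' z hz0).deriv] at h1
  linarith

/-- The open half-plane `t < 0`, the universal cover of the punctured disk in the logarithmic
polar coordinates `(t, θ)`. -/
def halfCyl : Set (ℝ × ℝ) := {q | q.1 < 0}

/-- The derivative in the first variable. -/
def dt (F : ℝ × ℝ → ℝ) (q : ℝ × ℝ) : ℝ := fderiv ℝ F q (1, 0)

/-- The derivative in the second variable. -/
def dθ (F : ℝ × ℝ → ℝ) (q : ℝ × ℝ) : ℝ := fderiv ℝ F q (0, 1)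

theorem isOpen_halfCyl : IsOpen halfCyl := isOpen_lt continuous_fst continuous_const

theorem hasFDerivAt_of_contDiffOn {F : ℝ × ℝ → ℝ} {n : WithTop ℕ∞} (hn : n ≠ 0)
    (hF : ContDiffOn ℝ n F halfCyl) {q : ℝ × ℝ} (hq : q ∈ halfCyl) :
    HasFDerivAt F (fderiv ℝ F q) q :=
  ((hF.differentiableOn hn).differentiableAt (isOpen_halfCyl.mem_nhds hq)).hasFDerivAt

theorem hasDerivAt_dt {F : ℝ × ℝ → ℝ} (hF : ContDiffOn ℝ 1 F halfCyl) {t : ℝ} (ht : t < 0)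
    (θ : ℝ) : HasDerivAt (fun s => F (s, θ)) (dt F (t, θ)) t :=
  (hasFDerivAt_of_contDiffOn one_ne_zero hF (q := (t, θ)) ht).comp_hasDerivAt t
    ((hasDerivAt_id t).prodMk (hasDerivAt_const t θ))

theorem hasDerivAt_dθ {F : ℝ × ℝ → ℝ} (hF : ContDiffOn ℝ 1 F halfCyl) {t : ℝ} (ht : t < 0)
    (θ : ℝ) : HasDerivAt (fun s => F (t, s)) (dθ F (t, θ)) θ :=
  (hasFDerivAt_of_contDiffOn one_ne_zero hF (q := (t, θ)) ht).comp_hasDerivAt θ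
    ((hasDerivAt_const θ t).prodMk (hasDerivAt_id θ))

theorem contDiffOn_dt {F : ℝ × ℝ → ℝ} {m n : WithTop ℕ∞} (hmn : m + 1 ≤ n)
    (hF : ContDiffOn ℝ n F halfCyl) : ContDiffOn ℝ m (dt F) halfCyl :=
  (hF.fderiv_of_isOpen isOpen_halfCyl hmn).clm_apply contDiffOn_const

theorem contDiffOn_dθ {F : ℝ × ℝ → ℝ} {m n : WithTop ℕ∞} (hmn : m + 1 ≤ n)
    (hF : ContDiffOn ℝ n F halfCyl) : ContDiffOn ℝ m (dθ F) halfCyl :=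
  (hF.fderiv_of_isOpen isOpen_halfCyl hmn).clm_apply contDiffOn_const

theorem continuous_slice {F : ℝ × ℝ → ℝ} (hF : ContinuousOn F halfCyl) {t : ℝ} (ht : t < 0) :
    Continuous fun θ => F (t, θ) :=
  hF.comp_continuous (by fun_prop) fun _ => ht

theorem dθ_dt_comm {F : ℝ × ℝ → ℝ} (hF : ContDiffOn ℝ 2 F halfCyl) {q : ℝ × ℝ}
    (hq : q ∈ halfCyl) : dθ (dt F) q = dt (dθ F) q := by
  have h2 : HasFDerivAt (fderiv ℝ F) (fderiv ℝ (fderiv ℝ F) q) q :=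
    (((hF.fderiv_of_isOpen isOpen_halfCyl (m := 1) (by norm_num)).differentiableOn
      one_ne_zero).differentiableAt (isOpen_halfCyl.mem_nhds hq)).hasFDerivAt
  have hv (v : ℝ × ℝ) : HasFDerivAt (fun p => fderiv ℝ F p v)
      ((fderiv ℝ (fderiv ℝ F) q).flip v) q := by
    simpa using h2.clm_apply (hasFDerivAt_const v q)
  have hsymm := second_derivative_symmetric_of_eventually (f := F) (f' := fderiv ℝ F)
    (f'' := fderiv ℝ (fderiv ℝ F) q) (x := q)
    (by filter_upwards [isOpen_halfCyl.mem_nhds hq] with p hp using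
          hasFDerivAt_of_contDiffOn two_ne_zero hF hp) h2 (0, 1) (1, 0)
  have e1 : dθ (dt F) q = fderiv ℝ (fun p => fderiv ℝ F p (1, 0)) q (0, 1) := rfl
  have e2 : dt (dθ F) q = fderiv ℝ (fun p => fderiv ℝ F p (0, 1)) q (1, 0) := rfl
  rw [e1, e2, (hv _).fderiv, (hv _).fderiv]
  simpa using hsymm

/-- Differentiation under the integral over the circles `t = const`. -/
theorem hasDerivAt_integral_circle {F : ℝ × ℝ → ℝ} (hF : ContDiffOn ℝ 1 F halfCyl) {t : ℝ}
    (ht : t < 0) :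
    HasDerivAt (fun s => ∫ θ in (-π)..π, F (s, θ)) (∫ θ in (-π)..π, dt F (t, θ)) t := by
  have hdt : ContinuousOn (dt F) halfCyl := (contDiffOn_dt (m := 0) (by norm_num) hF).continuousOn
  set S : Set ℝ := Icc (2 * t) (t / 2)
  have hS : S ∈ nhds t := Icc_mem_nhds (by linarith) (by linarith)
  have hSneg : ∀ s ∈ S, s < 0 := fun s hs => hs.2.trans_lt (by linarith)
  obtain ⟨C, hC⟩ := (isCompact_Icc (a := 2 * t) (b := t / 2)).prod
    (isCompact_Icc (a := -π) (b := π)) |>.exists_bound_of_continuousOn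
    (hdt.mono fun q hq => hSneg q.1 hq.1)
  have hcont : ∀ s ∈ S, Continuous fun θ => F (s, θ) := fun s hs =>
    continuous_slice hF.continuousOn (hSneg s hs)
  refine (intervalIntegral.hasDerivAt_integral_of_dominated_loc_of_deriv_le (bound := fun _ => C)
    (F' := fun s θ => dt F (s, θ)) hS ?_ ?_ ?_ ?_ ?_ ?_).2
  · filter_upwards [hS] with s hs using (hcont s hs).aestronglyMeasurable
  · exact (hcont t (mem_of_mem_nhds hS)).intervalIntegrable _ _
  · exact (continuous_slice hdt ht).aestronglyMeasurable
  · refine Filter.Eventually.of_forall fun θ hθ s hs => hC (s, θ) ⟨hs, ?_⟩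
    rw [uIoc_of_le (by linarith [pi_pos])] at hθ
    exact Ioc_subset_Icc_self hθ
  · simp
  · exact Filter.Eventually.of_forall fun θ _ s hs => hasDerivAt_dt hF (hSneg s hs) θ

/-- The integral of a `θ`-derivative of a periodic function over a circle vanishes. -/
theorem integral_dθ_eq_zero {F : ℝ × ℝ → ℝ} (hF : ContDiffOn ℝ 1 F halfCyl) {t : ℝ}
    (ht : t < 0) (hper : F (t, π) = F (t, -π)) : ∫ θ in (-π)..π, dθ F (t, θ) = 0 := by
  rw [intervalIntegral.integral_eq_sub_of_hasDerivAt (fun θ _ => hasDerivAt_dθ hF ht θ)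
    ((continuous_slice (contDiffOn_dθ (m := 0) (by norm_num) hF).continuousOn
      ht).intervalIntegrable _ _), hper, sub_self]

theorem dθ_mul {F G : ℝ × ℝ → ℝ} (hF : ContDiffOn ℝ 1 F halfCyl) (hG : ContDiffOn ℝ 1 G halfCyl)
    {q : ℝ × ℝ} (hq : q ∈ halfCyl) : dθ (fun x => F x * G x) q = dθ F q * G q + F q * dθ G q := by
  have := ((hasFDerivAt_of_contDiffOn one_ne_zero hF hq).mul
    (hasFDerivAt_of_contDiffOn one_ne_zero hG hq)).fderiv
  simp only [dθ]
  erw [this]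
  simp
  ring

theorem dt_mul {F G : ℝ × ℝ → ℝ} (hF : ContDiffOn ℝ 1 F halfCyl) (hG : ContDiffOn ℝ 1 G halfCyl)
    {q : ℝ × ℝ} (hq : q ∈ halfCyl) : dt (fun x => F x * G x) q = dt F q * G q + F q * dt G q := by
  have := ((hasFDerivAt_of_contDiffOn one_ne_zero hF hq).mul
    (hasFDerivAt_of_contDiffOn one_ne_zero hG hq)).fderiv
  simp only [dt]
  erw [this]
  simp
  ring

theorem circle_integral_add {f g : ℝ → ℝ} (hf : Continuous f) (hg : Continuous g) :
    ∫ θ in (-π)..π, (f θ + g θ) = (∫ θ in (-π)..π, f θ) + ∫ θ in (-π)..π, g θ :=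
  intervalIntegral.integral_add (hf.intervalIntegrable _ _) (hg.intervalIntegrable _ _)

theorem circle_integral_sub {f g : ℝ → ℝ} (hf : Continuous f) (hg : Continuous g) :
    ∫ θ in (-π)..π, (f θ - g θ) = (∫ θ in (-π)..π, f θ) - ∫ θ in (-π)..π, g θ :=
  intervalIntegral.integral_sub (hf.intervalIntegrable _ _) (hg.intervalIntegrable _ _)

theorem circle_integral_mono {f g : ℝ → ℝ} (hf : Continuous f) (hg : Continuous g)
    (hfg : ∀ θ, f θ ≤ g θ) : ∫ θ in (-π)..π, f θ ≤ ∫ θ in (-π)..π, g θ :=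
  intervalIntegral.integral_mono (by linarith [pi_pos]) (hf.intervalIntegrable _ _)
    (hg.intervalIntegrable _ _) hfg

theorem dθ_periodic {F : ℝ × ℝ → ℝ} (hper : ∀ t θ, F (t, θ + 2 * π) = F (t, θ)) (t : ℝ) :
    dθ F (t, π) = dθ F (t, -π) := by
  have h1 : (fun q : ℝ × ℝ => F (q + (0, 2 * π))) = F := by
    funext ⟨s, θ⟩
    simpa using hper s θ
  have h2 := fderiv_comp_add_right (𝕜 := ℝ) (f := F) (x := (t, -π)) (0, 2 * π)
  rw [h1] at h2
  have h3 : ((t, -π) : ℝ × ℝ) + (0, 2 * π) = (t, π) := by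
    ext <;> simp
    ring
  rw [h3] at h2
  simp only [dθ, h2]

theorem contDiffOn_comp_snd {φ : ℝ → ℝ} {n : WithTop ℕ∞} (hφ : ContDiff ℝ n φ) :
    ContDiffOn ℝ n (fun q : ℝ × ℝ => φ q.2) halfCyl :=
  (hφ.comp contDiff_snd).contDiffOn

theorem dθ_comp_snd {φ : ℝ → ℝ} (hφ : ContDiff ℝ 1 φ) {t : ℝ} (ht : t < 0) (θ : ℝ) :
    dθ (fun q : ℝ × ℝ => φ q.2) (t, θ) = deriv φ θ :=
  (hasDerivAt_dθ (contDiffOn_comp_snd hφ) ht θ).unique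
    (hφ.differentiable one_ne_zero θ).hasDerivAt

theorem dt_comp_snd {φ : ℝ → ℝ} (hφ : ContDiff ℝ 1 φ) {t : ℝ} (ht : t < 0) (θ : ℝ) :
    dt (fun q : ℝ × ℝ => φ q.2) (t, θ) = 0 :=
  (hasDerivAt_dt (contDiffOn_comp_snd hφ) ht θ).unique (hasDerivAt_const t (φ θ))

/-- Integration by parts on the circles `t = const`. -/
theorem integral_dθ_mul {F G : ℝ × ℝ → ℝ} (hF : ContDiffOn ℝ 1 F halfCyl)
    (hG : ContDiffOn ℝ 1 G halfCyl) {t : ℝ} (ht : t < 0) (hFper : F (t, π) = F (t, -π))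
    (hGper : G (t, π) = G (t, -π)) :
    ∫ θ in (-π)..π, dθ F (t, θ) * G (t, θ) = -∫ θ in (-π)..π, F (t, θ) * dθ G (t, θ) := by
  have h := integral_dθ_eq_zero (hF.mul hG) ht (by simp [hFper, hGper])
  have hdF := continuous_slice (contDiffOn_dθ (m := 0) (by norm_num) hF).continuousOn ht
  have hdG := continuous_slice (contDiffOn_dθ (m := 0) (by norm_num) hG).continuousOn ht
  have hcF := continuous_slice hF.continuousOn ht
  have hcG := continuous_slice hG.continuousOn ht
  rw [intervalIntegral.integral_congr fun θ _ => dθ_mul hF hG (q := (t, θ)) ht,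
    circle_integral_add (hdF.fun_mul hcG) (hcF.fun_mul hdG)] at h
  linarith

theorem hasDerivAt_integral_mul_comp_snd {F : ℝ × ℝ → ℝ} {φ : ℝ → ℝ}
    (hF : ContDiffOn ℝ 1 F halfCyl) (hφ : ContDiff ℝ 1 φ) {t : ℝ} (ht : t < 0) :
    HasDerivAt (fun s => ∫ θ in (-π)..π, F (s, θ) * φ θ)
      (∫ θ in (-π)..π, dt F (t, θ) * φ θ) t := by
  have h := hasDerivAt_integral_circle (hF.mul (contDiffOn_comp_snd hφ)) ht
  rwa [intervalIntegral.integral_congr (g := fun θ => dt F (t, θ) * φ θ) fun θ _ => ?_] at h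
  refine (dt_mul hF (contDiffOn_comp_snd hφ) (q := (t, θ)) ht).trans ?_
  rw [dt_comp_snd hφ ht]
  ring

theorem abs_integral_mul_le {f φ : ℝ → ℝ} {C : ℝ} (hf : ∀ θ, |f θ| ≤ C) (hφ : ∀ θ, |φ θ| ≤ 1) :
    |∫ θ in (-π)..π, f θ * φ θ| ≤ 2 * π * C := by
  have := intervalIntegral.norm_integral_le_of_norm_le_const (a := -π) (b := π) (C := C)
    (f := fun θ => f θ * φ θ) fun θ _ => by
      rw [norm_mul, norm_eq_abs, norm_eq_abs]
      exact (mul_le_of_le_one_right (abs_nonneg _) (hφ θ)).trans (hf θ)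
  rw [norm_eq_abs] at this
  refine this.trans_eq ?_
  rw [abs_of_pos (by linarith [pi_pos])]
  ring

/-- Uniform convergence to zero at the end `t = 0` of the cylinder. -/
def VanishesAtZero (W : ℝ × ℝ → ℝ) : Prop :=
  ∀ ε > 0, ∃ δ < 0, ∀ t, δ < t → t < 0 → ∀ θ, |W (t, θ)| ≤ ε

/-- Uniform convergence to the constant `L` at the end `t = -∞` of the cylinder. -/
def TendsToAtBot (W : ℝ × ℝ → ℝ) (L : ℝ) : Prop :=
  ∀ ε > 0, ∃ T < 0, ∀ t < T, ∀ θ, |W (t, θ) - L| ≤ ε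

section PoissonCylinder

variable {W h : ℝ × ℝ → ℝ} {L C : ℝ}

theorem second_deriv_circle_average (hW : ContDiffOn ℝ 2 W halfCyl)
    (hper : ∀ t θ, W (t, θ + 2 * π) = W (t, θ))
    (heq : ∀ q ∈ halfCyl, dt (dt W) q + dθ (dθ W) q = -h q)
    {φ ψ : ℝ → ℝ} {κ : ℝ} (hφ : ContDiff ℝ 1 φ) (hψ : ContDiff ℝ 1 ψ)
    (hφ' : deriv φ = ψ) (hψ' : deriv ψ = fun θ => -(κ * φ θ)) (hφπ : φ π = φ (-π))
    (hψπ : ψ π = ψ (-π)) {t : ℝ} (ht : t < 0) :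
    ∫ θ in (-π)..π, dt (dt W) (t, θ) * φ θ =
      κ * (∫ θ in (-π)..π, W (t, θ) * φ θ) - ∫ θ in (-π)..π, h (t, θ) * φ θ := by
  have hW1 : ContDiffOn ℝ 1 W halfCyl := hW.of_le (by norm_num)
  have hWθ : ContDiffOn ℝ 1 (dθ W) halfCyl := contDiffOn_dθ (by norm_num) hW
  have hWt : ContDiffOn ℝ 1 (dt W) halfCyl := contDiffOn_dt (by norm_num) hW
  have hc1 := continuous_slice (contDiffOn_dθ (m := 0) (by norm_num) hWθ).continuousOn ht
  have hc2 := continuous_slice (contDiffOn_dt (m := 0) (by norm_num) hWt).continuousOn ht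
  have hcφ := hφ.continuous
  have hWπ : W (t, π) = W (t, -π) := by
    rw [← hper t (-π)]
    congr 2
    ring
  have e1 := integral_dθ_mul hWθ (contDiffOn_comp_snd hφ) ht (dθ_periodic hper t) hφπ
  have e2 := integral_dθ_mul hW1 (contDiffOn_comp_snd hψ) ht hWπ hψπ
  simp only [dθ_comp_snd hφ ht, dθ_comp_snd hψ ht, hφ', hψ'] at e1 e2
  have e3 : ∫ θ in (-π)..π, h (t, θ) * φ θ = ∫ θ in (-π)..π,
      (-(dt (dt W) (t, θ) * φ θ) - dθ (dθ W) (t, θ) * φ θ) := by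
    refine intervalIntegral.integral_congr fun θ _ => ?_
    have := heq (t, θ) ht
    linear_combination φ θ * this
  rw [circle_integral_sub (hc2.fun_mul hcφ).fun_neg (hc1.fun_mul hcφ), intervalIntegral.integral_neg, e1, e2] at e3
  have e4 : ∫ θ in (-π)..π, W (t, θ) * -(κ * φ θ) = -(κ * ∫ θ in (-π)..π, W (t, θ) * φ θ) := by
    rw [← intervalIntegral.integral_const_mul, ← intervalIntegral.integral_neg]
    exact intervalIntegral.integral_congr fun θ _ => by ring
  rw [e4] at e3
  linarith

theorem abs_circle_average_le (hW : ContDiffOn ℝ 2 W halfCyl)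
    (hper : ∀ t θ, W (t, θ + 2 * π) = W (t, θ))
    (heq : ∀ q ∈ halfCyl, dt (dt W) q + dθ (dθ W) q = -h q)
    (hC : ∀ q ∈ halfCyl, |h q| ≤ C) (h0 : VanishesAtZero W) (hbot : TendsToAtBot W L)
    {φ ψ : ℝ → ℝ} {κ : ℝ} (hκ : 0 < κ) (hφ : ContDiff ℝ 1 φ) (hψ : ContDiff ℝ 1 ψ)
    (hφ' : deriv φ = ψ) (hψ' : deriv ψ = fun θ => -(κ * φ θ)) (hφπ : φ π = φ (-π))
    (hψπ : ψ π = ψ (-π)) (hφ1 : ∀ θ, |φ θ| ≤ 1) {t : ℝ} (ht : t < 0) :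
    |∫ θ in (-π)..π, W (t, θ) * φ θ| ≤ 2 * π * C / κ := by
  wlog hsign : 0 ≤ ∫ θ in (-π)..π, W (t, θ) * φ θ generalizing φ ψ
  · have := this (φ := fun θ => -φ θ) (ψ := fun θ => -ψ θ) hφ.neg hψ.neg
      (by rw [deriv.fun_neg', hφ']) (by rw [deriv.fun_neg', hψ']; funext θ; ring)
      (by simp [hφπ]) (by simp [hψπ]) (by simpa using hφ1)
      (by
        simp only [mul_neg, intervalIntegral.integral_neg]
        linarith)
    simpa only [mul_neg, intervalIntegral.integral_neg, abs_neg] using this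
  have hW1 : ContDiffOn ℝ 1 W halfCyl := hW.of_le (by norm_num)
  have hWt : ContDiffOn ℝ 1 (dt W) halfCyl := contDiffOn_dt (by norm_num) hW
  have hφ0 : ∫ θ in (-π)..π, φ θ = 0 := by
    have h1 := intervalIntegral.integral_deriv_eq_sub' ψ (a := -π) (b := π) hψ'
      (fun x _ => hψ.differentiable one_ne_zero x)
      (hφ.continuous.const_smul κ |>.neg.continuousOn)
    rw [intervalIntegral.integral_neg, intervalIntegral.integral_const_mul, hψπ, sub_self] at h1
    simpa [hκ.ne'] using h1
  have hCnn : 0 ≤ C := (abs_nonneg _).trans (hC (t, 0) ht)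
  have hpi := pi_pos
  rw [abs_of_nonneg hsign]
  refine le_div_of_second_deriv_eq hκ (by positivity)
    (fun s hs => hasDerivAt_integral_mul_comp_snd hW1 hφ hs)
    (fun s hs => hasDerivAt_integral_mul_comp_snd hWt hφ hs)
    (fun s hs => ?_) (fun ε hε => ?_) (fun ε hε => ?_) ht
  · rw [second_deriv_circle_average hW hper heq hφ hψ hφ' hψ' hφπ hψπ hs]
    have := (abs_le.1 (abs_integral_mul_le (fun θ => hC (s, θ) hs) hφ1)).2
    linarith
  · obtain ⟨δ, hδ, H⟩ := h0 (ε / (2 * π)) (by positivity)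
    refine ⟨δ, hδ, fun s hs1 hs2 => ?_⟩
    have := (abs_le.1 (abs_integral_mul_le (H s hs1 hs2) hφ1)).2
    rwa [mul_div_cancel₀ _ (by positivity)] at this
  · obtain ⟨T, hT, H⟩ := hbot (ε / (2 * π)) (by positivity)
    refine ⟨T, hT, fun s hs => ?_⟩
    have := (abs_le.1 (abs_integral_mul_le (H s hs) hφ1)).2
    rw [mul_div_cancel₀ _ (by positivity)] at this
    have hcW := continuous_slice hW.continuousOn (hs.trans hT)
    have hcφ := hφ.continuous
    simp only [sub_mul] at this
    rwa [circle_integral_sub (hcW.fun_mul hcφ) (by fun_prop), intervalIntegral.integral_const_mul,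
      hφ0, mul_zero, sub_zero] at this

end PoissonCylinder

theorem neg_pi_lt_pi : -π < π := by linarith [pi_pos]

theorem norm_fourierCoeffOn_le {g : ℝ → ℝ} (hg : Continuous g) (n : ℤ) :
    ‖fourierCoeffOn neg_pi_lt_pi (fun θ => (g θ : ℂ)) n‖ ≤ (2 * π)⁻¹ *
      (|∫ θ in (-π)..π, g θ * cos (n * θ)| + |∫ θ in (-π)..π, g θ * sin (n * θ)|) := by
  have hpi := pi_pos
  have hpt : ∀ θ : ℝ, fourier (-n) (θ : AddCircle (π - -π)) • (g θ : ℂ) =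
      ((g θ * cos (n * θ) : ℝ) : ℂ) - ((g θ * sin (n * θ) : ℝ) : ℂ) * Complex.I := by
    intro θ
    rw [fourier_coe_apply]
    have : (2 * π * Complex.I * ((-n : ℤ) : ℂ) * θ / ((π - -π : ℝ) : ℂ)) =
        ((-(n * θ) : ℝ) : ℂ) * Complex.I := by
      have hpiC : (π : ℂ) ≠ 0 := by exact_mod_cast hpi.ne'
      push_cast
      field_simp
      ring
    rw [this, Complex.exp_mul_I, ← Complex.ofReal_cos, ← Complex.ofReal_sin, cos_neg, sin_neg,
      smul_eq_mul]
    push_cast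
    ring
  have hi1 : IntervalIntegrable (fun θ : ℝ => ((g θ * cos (n * θ) : ℝ) : ℂ)) volume (-π) π :=
    Continuous.intervalIntegrable (by fun_prop) _ _
  have hi2 : IntervalIntegrable (fun θ : ℝ => ((g θ * sin (n * θ) : ℝ) : ℂ) * Complex.I)
      volume (-π) π :=
    Continuous.intervalIntegrable (by fun_prop) _ _
  rw [fourierCoeffOn_eq_integral, intervalIntegral.integral_congr fun θ _ => hpt θ,
    intervalIntegral.integral_sub hi1 hi2, intervalIntegral.integral_mul_const,
    intervalIntegral.integral_ofReal, intervalIntegral.integral_ofReal, norm_smul]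
  have h1 : ‖1 / (π - -π)‖ = (2 * π)⁻¹ := by
    rw [norm_eq_abs, abs_of_pos (by apply one_div_pos.2; linarith), one_div]
    congr 1
    ring
  rw [h1]
  gcongr
  refine (norm_sub_le _ _).trans (add_le_add ?_ ?_)
  · rw [Complex.norm_real, norm_eq_abs]
  · rw [norm_mul, Complex.norm_real, norm_eq_abs, Complex.norm_I, mul_one]

theorem norm_fourierCoeffOn_deriv {g g' : ℝ → ℝ} (hg : ∀ θ, HasDerivAt g (g' θ) θ)
    (hg' : Continuous g') (hper : g π = g (-π)) {n : ℤ} (hn : n ≠ 0) :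
    ‖fourierCoeffOn neg_pi_lt_pi (fun θ => (g' θ : ℂ)) n‖ =
      |(n : ℝ)| * ‖fourierCoeffOn neg_pi_lt_pi (fun θ => (g θ : ℂ)) n‖ := by
  have hpi := pi_pos
  have hpiC : (π : ℂ) ≠ 0 := by exact_mod_cast hpi.ne'
  have hnC : (n : ℂ) ≠ 0 := by exact_mod_cast hn
  have h := fourierCoeffOn_of_hasDerivAt neg_pi_lt_pi (f := fun θ => (g θ : ℂ))
    (f' := fun θ => (g' θ : ℂ)) hn (fun θ _ => (hg θ).ofReal_comp)
    (Continuous.intervalIntegrable (by fun_prop) _ _)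
  rw [hper, sub_self, mul_zero, zero_sub] at h
  have h2 : fourierCoeffOn neg_pi_lt_pi (fun θ => (g' θ : ℂ)) n =
      (n : ℂ) * Complex.I * fourierCoeffOn neg_pi_lt_pi (fun θ => (g θ : ℂ)) n := by
    rw [h]
    push_cast
    field_simp
    ring
  rw [h2, norm_mul, norm_mul, Complex.norm_I, mul_one, Complex.norm_intCast]

theorem fourierCoeffOn_deriv_zero {g g' : ℝ → ℝ} (hg : ∀ θ, HasDerivAt g (g' θ) θ)
    (hg' : Continuous g') (hper : g π = g (-π)) :
    fourierCoeffOn neg_pi_lt_pi (fun θ => (g' θ : ℂ)) 0 = 0 := by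
  rw [fourierCoeffOn_eq_integral]
  simp only [neg_zero, fourier_zero, one_smul]
  rw [intervalIntegral.integral_ofReal, intervalIntegral.integral_eq_sub_of_hasDerivAt
    (fun θ _ => hg θ) (hg'.intervalIntegrable _ _), hper]
  simp

/-- For a solution of the Poisson equation on the half-cylinder with bounded right-hand side and
zero boundary values at `t = 0`, the angular energy of the circles tends to zero as `t → 0`. -/
theorem tendsto_angular_energy {W h : ℝ × ℝ → ℝ} {L C : ℝ} (hW : ContDiffOn ℝ 2 W halfCyl)
    (hper : ∀ t θ, W (t, θ + 2 * π) = W (t, θ))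
    (heq : ∀ q ∈ halfCyl, dt (dt W) q + dθ (dθ W) q = -h q)
    (hC : ∀ q ∈ halfCyl, |h q| ≤ C) (h0 : VanishesAtZero W) (hbot : TendsToAtBot W L) :
    Filter.Tendsto (fun t => ∫ θ in (-π)..π, dθ W (t, θ) ^ 2) (nhdsWithin 0 (Iio 0))
      (nhds 0) := by
  have hpi := pi_pos
  have hW1 : ContDiffOn ℝ 1 W halfCyl := hW.of_le (by norm_num)
  have hd : ∀ t < 0, Continuous fun θ => dθ W (t, θ) := fun t ht =>
    continuous_slice (contDiffOn_dθ (m := 1) (by norm_num) hW).continuousOn ht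
  have hWπ : ∀ t, W (t, π) = W (t, -π) := fun t => by
    rw [← hper t (-π)]
    congr 2
    ring
  set a : ℝ → ℤ → ℝ := fun t n =>
    ‖fourierCoeffOn neg_pi_lt_pi (fun θ => (dθ W (t, θ) : ℂ)) n‖ ^ 2 with ha
  have hsum : ∀ t < 0, ∑' n, a t n = (2 * π)⁻¹ * ∫ θ in (-π)..π, dθ W (t, θ) ^ 2 := by
    intro t ht
    have hc : Continuous fun θ => (dθ W (t, θ) : ℂ) := Complex.continuous_ofReal.comp (hd t ht)
    have hmem : MemLp (fun θ => (dθ W (t, θ) : ℂ)) 2 (volume.restrict (Ioc (-π) π)) :=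
      (memLp_two_iff_integrable_sq_norm hc.aestronglyMeasurable).2
        (hc.norm.pow 2).integrableOn_Ioc
    have := tsum_sq_fourierCoeffOn neg_pi_lt_pi hmem
    simp only [Complex.norm_real, norm_eq_abs, sq_abs, smul_eq_mul] at this
    rw [this]
    congr 2
    ring
  have hmode : ∀ n : ℤ, n ≠ 0 → ∀ t < 0, ∀ B : ℝ,
      |∫ θ in (-π)..π, W (t, θ) * cos (n * θ)| ≤ 2 * π * B →
      |∫ θ in (-π)..π, W (t, θ) * sin (n * θ)| ≤ 2 * π * B → a t n ≤ (2 * (n : ℝ) * B) ^ 2 := by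
    intro n hn t ht B h1 h2
    have h3 := norm_fourierCoeffOn_le (continuous_slice hW.continuousOn ht) n
    have h4 : ‖fourierCoeffOn neg_pi_lt_pi (fun θ => (W (t, θ) : ℂ)) n‖ ≤ 2 * B := by
      refine h3.trans ?_
      calc (2 * π)⁻¹ * _ ≤ (2 * π)⁻¹ * (2 * π * B + 2 * π * B) := by gcongr
        _ = 2 * B := by field_simp; ring
    simp only [ha]
    rw [norm_fourierCoeffOn_deriv (hasDerivAt_dθ hW1 ht) (hd t ht) (hWπ t) hn, mul_pow, sq_abs]
    calc (n : ℝ) ^ 2 * _ ^ 2 ≤ (n : ℝ) ^ 2 * (2 * B) ^ 2 := by gcongr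
      _ = _ := by ring
  have hzero : ∀ t < 0, a t 0 = 0 := by
    intro t ht
    simp only [ha]
    rw [fourierCoeffOn_deriv_zero (hasDerivAt_dθ hW1 ht) (hd t ht) (hWπ t)]
    simp
  have hlim : Filter.Tendsto (fun t => ∑' n, a t n) (nhdsWithin 0 (Iio 0))
      (nhds (∑' _ : ℤ, (0 : ℝ))) := by
    refine tendsto_tsum_of_dominated_convergence (bound := fun n : ℤ =>
      (2 * C) ^ 2 * (1 / (n : ℝ) ^ 2))
      ((Real.summable_one_div_int_pow.2 one_lt_two).mul_left _) (fun n => ?_) ?_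
    · by_cases hn : n = 0
      · refine (tendsto_const_nhds (x := (0 : ℝ))).congr' ?_
        filter_upwards [self_mem_nhdsWithin] with t ht
        rw [hn, hzero t ht]
      · have hnR : (n : ℝ) ≠ 0 := by exact_mod_cast hn
        rw [Metric.tendsto_nhds]
        intro ε hε
        set B : ℝ := sqrt (ε / 2) / |2 * (n : ℝ)| with hB
        have hBpos : 0 < B := by positivity
        obtain ⟨δ, hδ, H⟩ := h0 B hBpos
        filter_upwards [Ioo_mem_nhdsLT hδ] with t ht
        have h1 := hmode n hn t ht.2 B
          (abs_integral_mul_le (H t ht.1 ht.2) fun θ => abs_cos_le_one _)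
          (abs_integral_mul_le (H t ht.1 ht.2) fun θ => abs_sin_le_one _)
        have h2 : (2 * (n : ℝ) * B) ^ 2 = ε / 2 := by
          rw [mul_pow, hB, div_pow, sq_sqrt (by positivity), sq_abs]
          field_simp
        rw [dist_zero_right, norm_eq_abs, abs_of_nonneg (by simp only [ha]; positivity)]
        linarith
    · filter_upwards [self_mem_nhdsWithin] with t ht n
      rw [norm_eq_abs, abs_of_nonneg (by simp only [ha]; positivity)]
      by_cases hn : n = 0
      · rw [hn, hzero t ht]
        positivity
      · have hnR : (n : ℝ) ≠ 0 := by exact_mod_cast hn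
        have hder_cos : deriv (fun θ : ℝ => cos (n * θ)) = fun θ => -(n * sin (n * θ)) := by
          funext θ
          exact (((hasDerivAt_id θ).const_mul (n : ℝ)).cos.deriv).trans (by simp; ring)
        have hder_sin : deriv (fun θ : ℝ => sin (n * θ)) = fun θ => n * cos (n * θ) := by
          funext θ
          exact (((hasDerivAt_id θ).const_mul (n : ℝ)).sin.deriv).trans (by simp; ring)
        have hsinpi : sin (n * π) = 0 := sin_int_mul_pi n
        have key := hmode n hn t ht (C / (n : ℝ) ^ 2)
          ((abs_circle_average_le hW hper heq hC h0 hbot (κ := (n : ℝ) ^ 2)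
            (φ := fun θ => cos (n * θ)) (ψ := fun θ => -(n * sin (n * θ))) (by positivity)
            (by fun_prop) (by fun_prop) hder_cos
            (by
              rw [deriv.fun_neg', deriv_const_mul_field', hder_sin]
              funext θ
              ring) (by simp) (by simp [hsinpi])
            (fun θ => abs_cos_le_one _) ht).trans_eq (by ring))
          ((abs_circle_average_le hW hper heq hC h0 hbot (κ := (n : ℝ) ^ 2)
            (φ := fun θ => sin (n * θ)) (ψ := fun θ => n * cos (n * θ)) (by positivity)
            (by fun_prop) (by fun_prop) hder_sin
            (by
              rw [deriv_const_mul_field', hder_cos]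
              funext θ
              ring) (by simp [hsinpi]) (by simp)
            (fun θ => abs_sin_le_one _) ht).trans_eq (by ring))
        refine key.trans_eq ?_
        field_simp
  rw [tsum_zero] at hlim
  have hlim2 := hlim.const_mul (2 * π)
  rw [mul_zero] at hlim2
  refine hlim2.congr' ?_
  filter_upwards [self_mem_nhdsWithin] with t ht
  rw [hsum t ht]
  field_simp

/-- A bounded positive solution `W` of `ΔW = -G W ^ p` on the half-cylinder, with zero boundary
values at `t = 0` and a limit at `t = -∞`, for a weight `G` whose logarithmic `t`-derivative is at
most `M`. -/
structure IsCylinderSolution (W G : ℝ × ℝ → ℝ) (p M C₀ C₁ L : ℝ) : Prop where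
  contDiffOn : ContDiffOn ℝ 2 W halfCyl
  contDiffOn_weight : ContDiffOn ℝ 1 G halfCyl
  periodic : ∀ t θ, W (t, θ + 2 * π) = W (t, θ)
  pos : ∀ q ∈ halfCyl, 0 < W q
  le : ∀ q ∈ halfCyl, W q ≤ C₀
  weight_nonneg : ∀ q ∈ halfCyl, 0 ≤ G q
  weight_le : ∀ q ∈ halfCyl, G q ≤ C₁
  dt_weight_le : ∀ q ∈ halfCyl, dt G q ≤ M * G q
  laplace_eq : ∀ q ∈ halfCyl, dt (dt W) q + dθ (dθ W) q = -(G q * W q ^ p)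
  vanishes : VanishesAtZero W
  tendsTo : TendsToAtBot W L
  weight_tendsTo : TendsToAtBot G 0

namespace IsCylinderSolution

variable {W G : ℝ × ℝ → ℝ} {p M C₀ C₁ L : ℝ}

theorem contDiffOn_one (S : IsCylinderSolution W G p M C₀ C₁ L) : ContDiffOn ℝ 1 W halfCyl :=
  S.contDiffOn.of_le (by norm_num)

theorem contDiffOn_dt (S : IsCylinderSolution W G p M C₀ C₁ L) :
    ContDiffOn ℝ 1 (dt W) halfCyl :=
  _root_.contDiffOn_dt (by norm_num) S.contDiffOn

theorem contDiffOn_dθ (S : IsCylinderSolution W G p M C₀ C₁ L) :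
    ContDiffOn ℝ 1 (dθ W) halfCyl :=
  _root_.contDiffOn_dθ (by norm_num) S.contDiffOn

theorem apply_pi (S : IsCylinderSolution W G p M C₀ C₁ L) (t : ℝ) : W (t, π) = W (t, -π) := by
  rw [← S.periodic t (-π)]
  congr 2
  ring

theorem dt_periodic (S : IsCylinderSolution W G p M C₀ C₁ L) {t : ℝ} (ht : t < 0) :
    dt W (t, π) = dt W (t, -π) := by
  refine (hasDerivAt_dt S.contDiffOn_one ht π).unique ?_
  simp_rw [S.apply_pi]
  exact hasDerivAt_dt S.contDiffOn_one ht (-π)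

theorem contDiffOn_rpow (S : IsCylinderSolution W G p M C₀ C₁ L) (r : ℝ) :
    ContDiffOn ℝ 1 (fun q => W q ^ r) halfCyl :=
  S.contDiffOn_one.rpow_const_of_ne fun q hq => (S.pos q hq).ne'

theorem source_nonneg (S : IsCylinderSolution W G p M C₀ C₁ L) {q : ℝ × ℝ} (hq : q ∈ halfCyl) :
    0 ≤ G q * W q ^ p :=
  mul_nonneg (S.weight_nonneg q hq) (rpow_nonneg (S.pos q hq).le _)

theorem abs_source_le (S : IsCylinderSolution W G p M C₀ C₁ L) (hp : 0 < p) {q : ℝ × ℝ}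
    (hq : q ∈ halfCyl) : |G q * W q ^ p| ≤ C₁ * C₀ ^ p := by
  rw [abs_of_nonneg (S.source_nonneg hq)]
  exact mul_le_mul (S.weight_le q hq) (rpow_le_rpow (S.pos q hq).le (S.le q hq) hp.le)
    (rpow_nonneg (S.pos q hq).le _) ((S.weight_nonneg q hq).trans (S.weight_le q hq))

theorem continuous_source (S : IsCylinderSolution W G p M C₀ C₁ L) (r : ℝ) {t : ℝ} (ht : t < 0) :
    Continuous fun θ => G (t, θ) * W (t, θ) ^ r :=
  continuous_slice (S.contDiffOn_weight.mul (S.contDiffOn_rpow r)).continuousOn ht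

/-- The flux through the circles `t = const`. -/
theorem hasDerivAt_flux (S : IsCylinderSolution W G p M C₀ C₁ L) {t : ℝ} (ht : t < 0) :
    HasDerivAt (fun s => ∫ θ in (-π)..π, dt W (s, θ))
      (-∫ θ in (-π)..π, G (t, θ) * W (t, θ) ^ p) t := by
  convert hasDerivAt_integral_circle S.contDiffOn_dt ht using 1
  have hc := continuous_slice (_root_.contDiffOn_dθ (m := 0) (by norm_num)
    S.contDiffOn_dθ).continuousOn ht
  have h1 : ∫ θ in (-π)..π, dt (dt W) (t, θ) =
      ∫ θ in (-π)..π, (-(G (t, θ) * W (t, θ) ^ p) - dθ (dθ W) (t, θ)) :=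
    intervalIntegral.integral_congr fun θ _ => by linarith [S.laplace_eq (t, θ) ht]
  rw [h1, circle_integral_sub (S.continuous_source p ht).fun_neg hc,
    integral_dθ_eq_zero S.contDiffOn_dθ ht (dθ_periodic S.periodic t),
    intervalIntegral.integral_neg, sub_zero]

theorem antitoneOn_flux (S : IsCylinderSolution W G p M C₀ C₁ L) :
    AntitoneOn (fun s => ∫ θ in (-π)..π, dt W (s, θ)) (Iio 0) :=
  antitoneOn_Iio_of_hasDerivAt (fun _ ht => S.hasDerivAt_flux ht) fun _ ht =>
    neg_nonpos.2 <| intervalIntegral.integral_nonneg neg_pi_lt_pi.le fun _ _ => S.source_nonneg ht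

theorem flux_nonpos (S : IsCylinderSolution W G p M C₀ C₁ L) {t : ℝ} (ht : t < 0) :
    ∫ θ in (-π)..π, dt W (t, θ) ≤ 0 := by
  by_contra! hpos
  obtain ⟨s, hs, h⟩ := exists_lt_of_hasDerivAt_le_neg 0 hpos
    (f := fun s => -∫ θ in (-π)..π, W (s, θ)) (f' := fun s => -∫ θ in (-π)..π, dt W (s, θ))
    (T := t) (fun s hs => (hasDerivAt_integral_circle S.contDiffOn_one (hs.trans ht)).neg)
    (fun s hs => neg_le_neg (S.antitoneOn_flux (hs.trans ht) ht hs.le))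
  have : 0 ≤ ∫ θ in (-π)..π, W (s, θ) :=
    intervalIntegral.integral_nonneg neg_pi_lt_pi.le fun θ _ => (S.pos (s, θ) (hs.trans ht)).le
  linarith

/-- The density of the Pohozaev energy. -/
def energyDensity (W G : ℝ × ℝ → ℝ) (p : ℝ) (q : ℝ × ℝ) : ℝ :=
  (dt W q * dt W q - dθ W q * dθ W q) / 2 + G q * W q ^ (p + 1) / (p + 1)

theorem contDiffOn_energyDensity (S : IsCylinderSolution W G p M C₀ C₁ L) :
    ContDiffOn ℝ 1 (energyDensity W G p) halfCyl :=
  (((S.contDiffOn_dt.mul S.contDiffOn_dt).sub (S.contDiffOn_dθ.mul S.contDiffOn_dθ)).div_const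
    2).add ((S.contDiffOn_weight.mul (S.contDiffOn_rpow (p + 1))).div_const (p + 1))

theorem dt_energyDensity (S : IsCylinderSolution W G p M C₀ C₁ L) (hp : 0 < p) {q : ℝ × ℝ}
    (hq : q ∈ halfCyl) : dt (energyDensity W G p) q =
      dt G q * W q ^ (p + 1) / (p + 1) - dθ (fun x => dθ W x * dt W x) q := by
  obtain ⟨t, θ⟩ := q
  have ht : t < 0 := hq
  have h1 := hasDerivAt_dt S.contDiffOn_dt ht θ
  have h2 := hasDerivAt_dt S.contDiffOn_dθ ht θ
  have h3 := hasDerivAt_dt S.contDiffOn_weight ht θ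
  have h4 := (hasDerivAt_dt S.contDiffOn_one ht θ).rpow_const (p := p + 1)
    (Or.inl (S.pos _ hq).ne')
  have h5 := (((h1.mul h1).sub (h2.mul h2)).div_const 2).add ((h3.mul h4).div_const (p + 1))
  have h6 := (hasDerivAt_dt S.contDiffOn_energyDensity ht θ).unique h5
  rw [h6, dθ_mul S.contDiffOn_dθ S.contDiffOn_dt hq, dθ_dt_comm S.contDiffOn hq,
    add_sub_cancel_right]
  have h7 := S.laplace_eq _ hq
  have hp1 : p + 1 ≠ 0 := by positivity
  field_simp
  linear_combination (2 * dt W (t, θ) * (p + 1)) * h7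

theorem integral_dt_energyDensity_le (S : IsCylinderSolution W G p M C₀ C₁ L) (hp : 0 < p)
    (hM : 0 ≤ M) {t : ℝ} (ht : t < 0) : ∫ θ in (-π)..π, dt (energyDensity W G p) (t, θ) ≤
      M * C₀ / (p + 1) * ∫ θ in (-π)..π, G (t, θ) * W (t, θ) ^ p := by
  have hF : ContDiffOn ℝ 1 (fun x => dθ W x * dt W x) halfCyl :=
    S.contDiffOn_dθ.mul S.contDiffOn_dt
  have hc1 := continuous_slice (_root_.contDiffOn_dθ (m := 0) (by norm_num) hF).continuousOn ht
  have hc2 := continuous_slice (_root_.contDiffOn_dt (m := 0) (by norm_num)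
    S.contDiffOn_weight).continuousOn ht
  have hc3 := continuous_slice (S.contDiffOn_rpow (p + 1)).continuousOn ht
  have hc4 : Continuous fun θ => dt G (t, θ) * W (t, θ) ^ (p + 1) / (p + 1) :=
    (hc2.mul hc3).div_const _
  rw [intervalIntegral.integral_congr fun θ _ => S.dt_energyDensity hp (q := (t, θ)) ht,
    circle_integral_sub hc4 hc1,
    integral_dθ_eq_zero hF ht (by simp only [S.dt_periodic ht, dθ_periodic S.periodic t]),
    sub_zero, ← intervalIntegral.integral_const_mul]
  refine circle_integral_mono hc4 ((S.continuous_source p ht).const_mul _) fun θ => ?_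
  have hq : (t, θ) ∈ halfCyl := ht
  have hpos := S.pos _ hq
  rw [rpow_add_one hpos.ne', div_mul_eq_mul_div]
  refine div_le_div_of_nonneg_right ?_ (by positivity)
  have hs := S.source_nonneg hq
  have hr : 0 ≤ W (t, θ) ^ p * W (t, θ) := by positivity
  calc dt G (t, θ) * (W (t, θ) ^ p * W (t, θ))
      ≤ M * G (t, θ) * (W (t, θ) ^ p * W (t, θ)) :=
        mul_le_mul_of_nonneg_right (S.dt_weight_le _ hq) hr
    _ = M * (G (t, θ) * W (t, θ) ^ p) * W (t, θ) := by ring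
    _ ≤ M * (G (t, θ) * W (t, θ) ^ p) * C₀ :=
        mul_le_mul_of_nonneg_left (S.le _ hq) (by positivity)
    _ = M * C₀ * (G (t, θ) * W (t, θ) ^ p) := by ring

theorem exists_energy_le (S : IsCylinderSolution W G p M C₀ C₁ L) (hp : 0 < p) {T ε : ℝ}
    (hT : T < 0) (hε : 0 < ε) : ∃ t < T, ∫ θ in (-π)..π, energyDensity W G p (t, θ) ≤ ε := by
  by_contra! hlt
  have hpi := pi_pos
  have hC₀ : 0 < C₀ := (S.pos (T, 0) hT).trans_le (S.le _ hT)
  have hC₀p : 0 < C₀ ^ (p + 1) := rpow_pos_of_pos hC₀ _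
  set η : ℝ := ε / (4 * π) with hη
  have hηpos : 0 < η := by positivity
  obtain ⟨T', hT', hG⟩ := S.weight_tendsTo (η / C₀ ^ (p + 1)) (by positivity)
  have hint : ∀ t < min T T', ∫ θ in (-π)..π, G (t, θ) * W (t, θ) ^ (p + 1) ≤ ε / 2 := by
    intro t ht
    have ht0 : t < 0 := ht.trans_le (min_le_left _ _) |>.trans hT
    calc ∫ θ in (-π)..π, G (t, θ) * W (t, θ) ^ (p + 1) ≤ ∫ _ in (-π)..π, η := by
          refine circle_integral_mono (S.continuous_source _ ht0) continuous_const fun θ => ?_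
          have h1 := hG t (ht.trans_le (min_le_right _ _)) θ
          rw [sub_zero] at h1
          have h2 := (le_abs_self _).trans h1
          have hq : (t, θ) ∈ halfCyl := ht0
          calc G (t, θ) * W (t, θ) ^ (p + 1) ≤ η / C₀ ^ (p + 1) * C₀ ^ (p + 1) :=
                mul_le_mul h2 (rpow_le_rpow (S.pos _ hq).le (S.le _ hq) (by positivity))
                  (rpow_nonneg (S.pos _ hq).le _) (by positivity)
            _ = η := by field_simp
      _ = ε / 2 := by
          rw [intervalIntegral.integral_const, smul_eq_mul, hη]
          field_simp
          ring
  have hF : ContDiffOn ℝ 1 (fun x => dt W x * W x) halfCyl := S.contDiffOn_dt.mul S.contDiffOn_one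
  have hH : ContDiffOn ℝ 1 (fun x => W x * dθ W x) halfCyl := S.contDiffOn_one.mul S.contDiffOn_dθ
  obtain ⟨t, ht, h⟩ := exists_lt_of_second_deriv_ge (2 * π * (C₀ * C₀)) (half_pos hε)
    (T := min T T') (f := fun t => (∫ θ in (-π)..π, W (t, θ) * W (t, θ)) / 2)
    (f' := fun t => ∫ θ in (-π)..π, dt W (t, θ) * W (t, θ))
    (f'' := fun t => ∫ θ in (-π)..π, dt (fun x => dt W x * W x) (t, θ))
    (fun t ht => by
      have ht0 : t < 0 := ht.trans_le (min_le_left _ _) |>.trans hT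
      refine ((hasDerivAt_integral_circle (S.contDiffOn_one.mul S.contDiffOn_one)
        ht0).div_const 2).congr_deriv ?_
      rw [← intervalIntegral.integral_div]
      refine intervalIntegral.integral_congr fun θ _ => ?_
      refine (congrArg (· / 2)
        (dt_mul S.contDiffOn_one S.contDiffOn_one (q := (t, θ)) ht0)).trans ?_
      ring)
    (fun t ht => hasDerivAt_integral_circle hF (ht.trans_le (min_le_left _ _) |>.trans hT))
    (fun t ht => by
      have ht0 : t < 0 := ht.trans_le (min_le_left _ _) |>.trans hT
      have hc1 := continuous_slice S.contDiffOn_dt.continuousOn ht0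
      have hc2 := continuous_slice S.contDiffOn_dθ.continuousOn ht0
      have hc3 := continuous_slice (_root_.contDiffOn_dθ (m := 0) (by norm_num)
        hH).continuousOn ht0
      have hc4 := S.continuous_source (p + 1) ht0
      have hc5 := hc1.fun_mul hc1
      have hc6 := hc2.fun_mul hc2
      have e1 : ∫ θ in (-π)..π, dt (fun x => dt W x * W x) (t, θ) =
          ∫ θ in (-π)..π, (((dt W (t, θ) * dt W (t, θ) + dθ W (t, θ) * dθ W (t, θ)) -
            G (t, θ) * W (t, θ) ^ (p + 1)) - dθ (fun x => W x * dθ W x) (t, θ)) := by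
        refine intervalIntegral.integral_congr fun θ _ => ?_
        have hq : (t, θ) ∈ halfCyl := ht0
        rw [dt_mul S.contDiffOn_dt S.contDiffOn_one hq, dθ_mul S.contDiffOn_one S.contDiffOn_dθ hq,
          rpow_add_one (S.pos _ hq).ne']
        linear_combination W (t, θ) * S.laplace_eq _ hq
      have hθ : 0 ≤ ∫ θ in (-π)..π, dθ W (t, θ) * dθ W (t, θ) :=
        intervalIntegral.integral_nonneg neg_pi_lt_pi.le fun θ _ => mul_self_nonneg _
      have hGW : 0 ≤ ∫ θ in (-π)..π, G (t, θ) * W (t, θ) ^ (p + 1) :=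
        intervalIntegral.integral_nonneg neg_pi_lt_pi.le fun θ _ =>
          mul_nonneg (S.weight_nonneg _ ht0) (rpow_nonneg (S.pos _ ht0).le _)
      have hE := hlt t (ht.trans_le (min_le_left _ _))
      have e2 : ∫ θ in (-π)..π, energyDensity W G p (t, θ) =
          ((∫ θ in (-π)..π, dt W (t, θ) * dt W (t, θ)) -
            ∫ θ in (-π)..π, dθ W (t, θ) * dθ W (t, θ)) / 2 +
            (∫ θ in (-π)..π, G (t, θ) * W (t, θ) ^ (p + 1)) / (p + 1) := by
        simp only [energyDensity]
        rw [circle_integral_add ((hc5.fun_sub hc6).div_const 2) (hc4.div_const (p + 1)),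
          intervalIntegral.integral_div, intervalIntegral.integral_div,
          circle_integral_sub hc5 hc6]
      have e3 : (∫ θ in (-π)..π, G (t, θ) * W (t, θ) ^ (p + 1)) / (p + 1) ≤
          ∫ θ in (-π)..π, G (t, θ) * W (t, θ) ^ (p + 1) := div_le_self hGW (by linarith)
      rw [e1, circle_integral_sub ((hc5.fun_add hc6).fun_sub hc4) hc3,
        integral_dθ_eq_zero hH ht0 (by simp only [S.apply_pi, dθ_periodic S.periodic t]),
        circle_integral_sub (hc5.fun_add hc6) hc4, circle_integral_add hc5 hc6]
      linarith [hint t ht])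
  have ht0 : t < 0 := ht.trans_le (min_le_left _ _) |>.trans hT
  have hc := continuous_slice S.contDiffOn.continuousOn ht0
  have hle : ∫ θ in (-π)..π, W (t, θ) * W (t, θ) ≤ ∫ _ in (-π)..π, C₀ * C₀ :=
    circle_integral_mono (hc.fun_mul hc) continuous_const fun θ =>
      mul_le_mul (S.le _ ht0) (S.le _ ht0) (S.pos _ ht0).le hC₀.le
  rw [intervalIntegral.integral_const, smul_eq_mul] at hle
  have : 0 < π * (C₀ * C₀) := by positivity
  linarith

theorem energy_le (S : IsCylinderSolution W G p M C₀ C₁ L) (hp : 0 < p) (hM : 0 ≤ M) {t : ℝ}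
    (ht : t < 0) : ∫ θ in (-π)..π, energyDensity W G p (t, θ) ≤
      M * C₀ / (p + 1) * -∫ θ in (-π)..π, dt W (t, θ) := by
  have hC₀ : 0 < C₀ := (S.pos (t, 0) ht).trans_le (S.le _ ht)
  have hanti := antitoneOn_Iio_of_hasDerivAt
    (fun s hs => (hasDerivAt_integral_circle S.contDiffOn_energyDensity hs).add
      ((S.hasDerivAt_flux hs).const_mul (M * C₀ / (p + 1))))
    (fun s hs => by linarith [S.integral_dt_energyDensity_le hp hM hs])
  refine le_of_forall_pos_le_add fun ε hε => ?_
  obtain ⟨s, hs, hE⟩ := S.exists_energy_le hp ht hε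
  have h1 := hanti (hs.trans ht) ht hs.le
  have h2 := S.flux_nonpos (hs.trans ht)
  have h3 : 0 ≤ M * C₀ / (p + 1) := by positivity
  have h4 := mul_nonneg h3 (neg_nonneg.2 h2)
  simp only [Pi.add_apply] at h1
  linarith

theorem sq_flux_le (S : IsCylinderSolution W G p M C₀ C₁ L) (hp : 0 < p) (hM : 0 ≤ M) {t : ℝ}
    (ht : t < 0) : (∫ θ in (-π)..π, dt W (t, θ)) ^ 2 / (4 * π) ≤
      M * C₀ / (p + 1) * (-∫ θ in (-π)..π, dt W (t, θ)) +
        (∫ θ in (-π)..π, dθ W (t, θ) ^ 2) / 2 := by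
  have hpi := pi_pos
  have hc1 := continuous_slice S.contDiffOn_dt.continuousOn ht
  have hc2 := continuous_slice S.contDiffOn_dθ.continuousOn ht
  have hE := S.energy_le hp hM ht
  set m := ∫ θ in (-π)..π, dt W (t, θ) with hm
  have hle : ∫ θ in (-π)..π, (m / (2 * π) * dt W (t, θ) - m ^ 2 / (8 * π ^ 2) -
      dθ W (t, θ) ^ 2 / 2) ≤ ∫ θ in (-π)..π, energyDensity W G p (t, θ) := by
    refine circle_integral_mono ?_
      (continuous_slice S.contDiffOn_energyDensity.continuousOn ht) fun θ => ?_
    · exact ((hc1.const_mul _).sub continuous_const).sub ((hc2.fun_pow 2).div_const 2)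
    · have h1 : 0 ≤ G (t, θ) * W (t, θ) ^ (p + 1) / (p + 1) :=
        div_nonneg (mul_nonneg (S.weight_nonneg _ ht) (rpow_nonneg (S.pos _ ht).le _))
          (by positivity)
      have h2 := sq_nonneg (dt W (t, θ) - m / (2 * π))
      have h3 : m ^ 2 / (8 * π ^ 2) = (m / (2 * π)) ^ 2 / 2 := by
        field_simp
        ring
      simp only [energyDensity]
      rw [h3]
      linarith
  rw [circle_integral_sub ((hc1.const_mul _).fun_sub continuous_const) ((hc2.fun_pow 2).div_const 2),
    circle_integral_sub (hc1.const_mul _) continuous_const, intervalIntegral.integral_const,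
    intervalIntegral.integral_const_mul, intervalIntegral.integral_div, ← hm, smul_eq_mul] at hle
  have e : m / (2 * π) * m - (π - -π) * (m ^ 2 / (8 * π ^ 2)) = m ^ 2 / (4 * π) := by
    field_simp
    ring
  rw [e] at hle
  linarith

/-- The flux of a solution is controlled by the supremum bound: this is the Pohozaev identity
combined with the vanishing of the angular energy at `t = 0`. -/
theorem neg_flux_le (S : IsCylinderSolution W G p M C₀ C₁ L) (hp : 0 < p) (hM : 0 ≤ M) {t : ℝ}
    (ht : t < 0) : -∫ θ in (-π)..π, dt W (t, θ) ≤ 4 * π * (M * C₀ / (p + 1)) := by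
  by_contra! hlt
  have hpi := pi_pos
  have hC₀ : 0 < C₀ := (S.pos (t, 0) ht).trans_le (S.le _ ht)
  set c := M * C₀ / (p + 1) with hc
  have hc0 : 0 ≤ c := by positivity
  set x₀ := -∫ θ in (-π)..π, dt W (t, θ) with hx₀
  have hx₀pos : 0 < x₀ := lt_of_le_of_lt (by positivity) hlt
  have hκ : 0 < x₀ / (4 * π) - c := by
    rw [sub_pos, lt_div_iff₀ (by positivity)]
    linarith
  have hA := tendsto_angular_energy S.contDiffOn S.periodic S.laplace_eq
    (fun q hq => S.abs_source_le hp hq) S.vanishes S.tendsTo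
  have hev := hA.eventually (gt_mem_nhds (mul_pos hx₀pos hκ))
  obtain ⟨s, hs1, hs2⟩ := (hev.and (Ioo_mem_nhdsLT ht)).exists
  have h1 := S.sq_flux_le hp hM hs2.2
  have h2 := S.antitoneOn_flux ht hs2.2 hs2.1.le
  simp only at h2
  set x := -∫ θ in (-π)..π, dt W (s, θ) with hx
  have hxx : x₀ ≤ x := by
    rw [hx, hx₀]
    linarith
  have h3 : (∫ θ in (-π)..π, dt W (s, θ)) ^ 2 / (4 * π) = x * (x / (4 * π)) := by
    rw [hx]
    ring
  rw [h3, ← hc] at h1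
  have h4 : x₀ * (x₀ / (4 * π) - c) ≤ x * (x / (4 * π) - c) := by
    have : x₀ / (4 * π) ≤ x / (4 * π) := by gcongr
    exact mul_le_mul hxx (by linarith) hκ.le (by linarith)
  have h5 : 0 < x₀ * (x₀ / (4 * π) - c) := mul_pos hx₀pos hκ
  linarith

end IsCylinderSolution

/-- The logarithmic polar coordinates on the punctured plane. -/
def logPolar (q : ℝ × ℝ) : Plane := !₂[exp q.1 * cos q.2, exp q.1 * sin q.2]

/-- The rotation by a right angle. -/
def rightAngleRotation (x : Plane) : Plane := !₂[-x 1, x 0]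

theorem norm_logPolar (q : ℝ × ℝ) : ‖logPolar q‖ = exp q.1 := by
  rw [EuclideanSpace.norm_eq, Fin.sum_univ_two, sqrt_eq_iff_mul_self_eq (by positivity)
    (exp_pos _).le]
  simp only [logPolar, norm_eq_abs, sq_abs]
  simp only [Matrix.cons_val_zero, Matrix.cons_val_one]
  linear_combination (exp q.1) ^ 2 * sin_sq_add_cos_sq q.2

theorem logPolar_mem {q : ℝ × ℝ} (hq : q ∈ halfCyl) : logPolar q ∈ ball (0 : Plane) 1 \ {0} := by
  refine ⟨?_, fun h => ?_⟩
  · rw [mem_ball_zero_iff, norm_logPolar]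
    exact exp_lt_one_iff.2 hq
  · have := norm_logPolar q
    rw [mem_singleton_iff.1 h, norm_zero] at this
    exact (exp_pos _).ne this

theorem contDiff_logPolar {n : WithTop ℕ∞} : ContDiff ℝ n logPolar := by
  rw [contDiff_euclidean]
  intro i
  fin_cases i
  · exact contDiff_fst.exp.mul contDiff_snd.cos
  · exact contDiff_fst.exp.mul contDiff_snd.sin

theorem logPolar_add_two_pi (t θ : ℝ) : logPolar (t, θ + 2 * π) = logPolar (t, θ) := by
  simp [logPolar]

theorem hasDerivAt_plane {f : ℝ → Plane} {f' : Plane} {x : ℝ}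
    (h : ∀ i, HasDerivAt (fun s => f s i) (f' i) x) : HasDerivAt f f' x := by
  rw [← hasDerivWithinAt_univ, hasDerivWithinAt_iff_hasFDerivWithinAt,
    hasFDerivWithinAt_euclidean]
  exact fun i => (h i).hasFDerivAt.hasFDerivWithinAt.congr_fderiv (by ext; simp)

theorem hasDerivAt_logPolar_fst (t θ : ℝ) :
    HasDerivAt (fun s => logPolar (s, θ)) (logPolar (t, θ)) t := by
  refine hasDerivAt_plane fun i => ?_
  fin_cases i
  · exact (hasDerivAt_exp t).mul_const (cos θ)
  · exact (hasDerivAt_exp t).mul_const (sin θ)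

theorem hasDerivAt_logPolar_snd (t θ : ℝ) :
    HasDerivAt (fun s => logPolar (t, s)) (rightAngleRotation (logPolar (t, θ))) θ := by
  refine hasDerivAt_plane fun i => ?_
  fin_cases i
  · exact ((hasDerivAt_cos θ).const_mul (exp t)).congr_deriv (mul_neg _ _)
  · exact (hasDerivAt_sin θ).const_mul (exp t)

theorem hasDerivAt_rightAngleRotation_logPolar (t θ : ℝ) :
    HasDerivAt (fun s => rightAngleRotation (logPolar (t, s))) (-logPolar (t, θ)) θ := by
  refine hasDerivAt_plane fun i => ?_
  fin_cases i
  · exact ((hasDerivAt_sin θ).const_mul (exp t)).neg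
  · exact ((hasDerivAt_cos θ).const_mul (exp t)).congr_deriv (mul_neg _ _)

theorem isOpen_puncturedDisk : IsOpen (ball (0 : Plane) 1 \ {0}) :=
  isOpen_ball.sdiff isClosed_singleton

section Composition

variable {u : Plane → ℝ}

theorem contDiffOn_comp_logPolar {n : WithTop ℕ∞}
    (hu : ContDiffOn ℝ n u (ball (0 : Plane) 1 \ {0})) :
    ContDiffOn ℝ n (fun q => u (logPolar q)) halfCyl :=
  hu.comp contDiff_logPolar.contDiffOn fun _ => logPolar_mem

theorem hasFDerivAt_of_contDiffOn_puncturedDisk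
    (hu : ContDiffOn ℝ 1 u (ball (0 : Plane) 1 \ {0})) {x : Plane}
    (hx : x ∈ ball (0 : Plane) 1 \ {0}) : HasFDerivAt u (fderiv ℝ u x) x :=
  ((hu.differentiableOn one_ne_zero).differentiableAt
    (isOpen_puncturedDisk.mem_nhds hx)).hasFDerivAt

theorem dt_comp_logPolar (hu : ContDiffOn ℝ 1 u (ball (0 : Plane) 1 \ {0})) {t : ℝ} (ht : t < 0)
    (θ : ℝ) : dt (fun q => u (logPolar q)) (t, θ) =
      fderiv ℝ u (logPolar (t, θ)) (logPolar (t, θ)) :=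
  (hasDerivAt_dt (contDiffOn_comp_logPolar hu) ht θ).unique <|
    (hasFDerivAt_of_contDiffOn_puncturedDisk hu (logPolar_mem (q := (t, θ)) ht)).comp_hasDerivAt t
      (hasDerivAt_logPolar_fst t θ)

theorem dθ_comp_logPolar (hu : ContDiffOn ℝ 1 u (ball (0 : Plane) 1 \ {0})) {t : ℝ} (ht : t < 0)
    (θ : ℝ) : dθ (fun q => u (logPolar q)) (t, θ) =
      fderiv ℝ u (logPolar (t, θ)) (rightAngleRotation (logPolar (t, θ))) :=
  (hasDerivAt_dθ (contDiffOn_comp_logPolar hu) ht θ).unique <|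
    (hasFDerivAt_of_contDiffOn_puncturedDisk hu (logPolar_mem (q := (t, θ)) ht)).comp_hasDerivAt θ
      (hasDerivAt_logPolar_snd t θ)

theorem lap_eq_of_hasFDerivAt {x : Plane} {B : Plane →L[ℝ] Plane →L[ℝ] ℝ}
    (hB : HasFDerivAt (fderiv ℝ u) B x) : lap u x =
      B (EuclideanSpace.single 0 1) (EuclideanSpace.single 0 1) +
        B (EuclideanSpace.single 1 1) (EuclideanSpace.single 1 1) := by
  have hv (v : Plane) : HasFDerivAt (fun y => fderiv ℝ u y v) (B.flip v) x := by
    simpa using hB.clm_apply (hasFDerivAt_const v x)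
  simp only [lap, Fin.sum_univ_two, (hv _).fderiv, ContinuousLinearMap.flip_apply]

theorem bilin_add_bilin_rotation (B : Plane →L[ℝ] Plane →L[ℝ] ℝ) (x : Plane) :
    B x x + B (rightAngleRotation x) (rightAngleRotation x) = ‖x‖ ^ 2 *
      (B (EuclideanSpace.single 0 1) (EuclideanSpace.single 0 1) +
        B (EuclideanSpace.single 1 1) (EuclideanSpace.single 1 1)) := by
  have hx (y : Plane) : y = y 0 • EuclideanSpace.single (0 : Fin 2) (1 : ℝ) +
      y 1 • EuclideanSpace.single (1 : Fin 2) (1 : ℝ) := by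
    ext i
    fin_cases i <;> simp
  have h0 : rightAngleRotation x 0 = -x 1 := rfl
  have h1 : rightAngleRotation x 1 = x 0 := rfl
  have hB (y : Plane) : B y y = y 0 * (y 0 * B (EuclideanSpace.single 0 1)
      (EuclideanSpace.single 0 1)) + y 1 * (y 0 * B (EuclideanSpace.single 0 1)
      (EuclideanSpace.single 1 1)) + (y 0 * (y 1 * B (EuclideanSpace.single 1 1)
      (EuclideanSpace.single 0 1)) + y 1 * (y 1 * B (EuclideanSpace.single 1 1)
      (EuclideanSpace.single 1 1))) := by
    conv_lhs => rw [hx y]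
    simp only [map_add, map_smul, add_apply, smul_apply,
      smul_eq_mul]
    ring
  rw [hB x, hB (rightAngleRotation x), h0, h1, EuclideanSpace.real_norm_sq_eq, Fin.sum_univ_two]
  ring

theorem hasDerivAt_fderiv_apply {B : Plane →L[ℝ] Plane →L[ℝ] ℝ} {γ η : ℝ → Plane} {v w : Plane}
    {x : ℝ} (hB : HasFDerivAt (fderiv ℝ u) B (γ x)) (hγ : HasDerivAt γ v x)
    (hη : HasDerivAt η w x) :
    HasDerivAt (fun s => fderiv ℝ u (γ s) (η s)) (B v (η x) + fderiv ℝ u (γ x) w) x :=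
  (hB.comp_hasDerivAt x hγ).clm_apply hη

theorem laplace_comp_logPolar (hu : ContDiffOn ℝ 2 u (ball (0 : Plane) 1 \ {0})) {q : ℝ × ℝ}
    (hq : q ∈ halfCyl) :
    dt (dt fun q => u (logPolar q)) q + dθ (dθ fun q => u (logPolar q)) q =
      exp q.1 ^ 2 * lap u (logPolar q) := by
  obtain ⟨t, θ⟩ := q
  have ht : t < 0 := hq
  have hu1 : ContDiffOn ℝ 1 u (ball (0 : Plane) 1 \ {0}) := hu.of_le (by norm_num)
  have hB : HasFDerivAt (fderiv ℝ u) (fderiv ℝ (fderiv ℝ u) (logPolar (t, θ)))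
      (logPolar (t, θ)) :=
    (((hu.fderiv_of_isOpen isOpen_puncturedDisk (m := 1) (by norm_num)).differentiableOn
      one_ne_zero).differentiableAt (isOpen_puncturedDisk.mem_nhds (logPolar_mem hq))).hasFDerivAt
  have hW := contDiffOn_comp_logPolar hu
  have e1 := (hasDerivAt_dt (contDiffOn_dt (m := 1) (by norm_num) hW) ht θ).unique <|
    (hasDerivAt_fderiv_apply hB (hasDerivAt_logPolar_fst t θ)
      (hasDerivAt_logPolar_fst t θ)).congr_of_eventuallyEq <|
      Filter.mem_of_superset (Iio_mem_nhds ht) fun s hs => dt_comp_logPolar hu1 hs θ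
  have e2 := (hasDerivAt_dθ (contDiffOn_dθ (m := 1) (by norm_num) hW) ht θ).unique <|
    (hasDerivAt_fderiv_apply hB (hasDerivAt_logPolar_snd t θ)
      (hasDerivAt_rightAngleRotation_logPolar t θ)).congr_of_eventuallyEq <|
      Filter.Eventually.of_forall fun s => dθ_comp_logPolar hu1 ht s
  have e3 := bilin_add_bilin_rotation (fderiv ℝ (fderiv ℝ u) (logPolar (t, θ))) (logPolar (t, θ))
  rw [norm_logPolar, ← lap_eq_of_hasFDerivAt hB] at e3
  rw [e1, e2, ← e3, map_neg]
  ring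

end Composition

theorem norm_gradient_eq (K : Plane → ℝ) (y : Plane) : ‖gradient K y‖ = ‖fderiv ℝ K y‖ :=
  LinearIsometryEquiv.norm_map _ _

section Weight

variable {K : Plane → ℝ} {α : ℝ}

theorem bddAbove_norm_gradient (hK : ContDiffOn ℝ 1 K (closedBall (0 : Plane) 1)) :
    BddAbove (range fun y : ball (0 : Plane) 1 => ‖gradient K ↑y‖) := by
  have hud : UniqueDiffOn ℝ (closedBall (0 : Plane) 1) :=
    uniqueDiffOn_convex (convex_closedBall _ _)
      ⟨0, ball_subset_interior_closedBall (mem_ball_self one_pos)⟩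
  obtain ⟨C, hC⟩ := (isCompact_closedBall (0 : Plane) 1).exists_bound_of_continuousOn
    (hK.continuousOn_fderivWithin hud le_rfl)
  refine ⟨C, ?_⟩
  rintro _ ⟨⟨y, hy⟩, rfl⟩
  have h := hC y (ball_subset_closedBall hy)
  rwa [fderivWithin_of_mem_nhds (Filter.mem_of_superset (isOpen_ball.mem_nhds hy)
    ball_subset_closedBall), ← norm_gradient_eq] at h

theorem exists_pos_forall_le (hK : ContinuousOn K (closedBall (0 : Plane) 1))
    (hKpos : ∀ y ∈ closedBall (0 : Plane) 1, 0 < K y) :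
    ∃ k > 0, ∀ y ∈ closedBall (0 : Plane) 1, k ≤ K y := by
  obtain ⟨x, hx, hmin⟩ := (isCompact_closedBall (0 : Plane) 1).exists_isMinOn
    (nonempty_closedBall.2 zero_le_one) hK
  exact ⟨K x, hKpos x hx, hmin⟩

theorem exists_pos_forall_ge (hK : ContinuousOn K (closedBall (0 : Plane) 1))
    (hKpos : ∀ y ∈ closedBall (0 : Plane) 1, 0 < K y) :
    ∃ C > 0, ∀ y ∈ closedBall (0 : Plane) 1, K y ≤ C := by
  obtain ⟨x, hx, hmax⟩ := (isCompact_closedBall (0 : Plane) 1).exists_isMaxOn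
    (nonempty_closedBall.2 zero_le_one) hK
  exact ⟨K x, hKpos x hx, hmax⟩

theorem iInf_pos_of_continuousOn (hK : ContinuousOn K (closedBall (0 : Plane) 1))
    (hKpos : ∀ y ∈ closedBall (0 : Plane) 1, 0 < K y) : 0 < ⨅ y : ball (0 : Plane) 1, K ↑y := by
  obtain ⟨k, hk, hle⟩ := exists_pos_forall_le hK hKpos
  have : Nonempty (ball (0 : Plane) 1) := ⟨⟨0, mem_ball_self one_pos⟩⟩
  exact hk.trans_le (le_ciInf fun y => hle y (ball_subset_closedBall y.2))

theorem iInf_le_of_continuousOn (hK : ContinuousOn K (closedBall (0 : Plane) 1))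
    (hKpos : ∀ y ∈ closedBall (0 : Plane) 1, 0 < K y) {x : Plane} (hx : x ∈ ball (0 : Plane) 1) :
    ⨅ y : ball (0 : Plane) 1, K ↑y ≤ K x := by
  obtain ⟨k, hk, hle⟩ := exists_pos_forall_le hK hKpos
  refine ciInf_le ⟨k, ?_⟩ (⟨x, hx⟩ : ball (0 : Plane) 1)
  rintro _ ⟨y, rfl⟩
  exact hle y (ball_subset_closedBall y.2)

/-- The weight of the Hénon equation in logarithmic polar coordinates. -/
def cylWeight (K : Plane → ℝ) (α : ℝ) (q : ℝ × ℝ) : ℝ :=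
  exp ((2 + 2 * α) * q.1) * K (logPolar q)

theorem contDiffOn_cylWeight (hK : ContDiffOn ℝ 1 K (ball (0 : Plane) 1 \ {0})) :
    ContDiffOn ℝ 1 (cylWeight K α) halfCyl :=
  (contDiff_const.mul contDiff_fst).exp.contDiffOn.mul (contDiffOn_comp_logPolar hK)

theorem cylWeight_eq (K : Plane → ℝ) (α : ℝ) (q : ℝ × ℝ) :
    cylWeight K α q = exp q.1 ^ 2 * (‖logPolar q‖ ^ (2 * α) * K (logPolar q)) := by
  rw [cylWeight, norm_logPolar, ← exp_mul, ← mul_assoc, ← exp_nat_mul, ← exp_add]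
  congr 2
  push_cast
  ring

theorem dt_cylWeight (hK : ContDiffOn ℝ 1 K (ball (0 : Plane) 1 \ {0})) {q : ℝ × ℝ}
    (hq : q ∈ halfCyl) : dt (cylWeight K α) q = exp ((2 + 2 * α) * q.1) *
      ((2 + 2 * α) * K (logPolar q) + fderiv ℝ K (logPolar q) (logPolar q)) := by
  obtain ⟨t, θ⟩ := q
  have ht : t < 0 := hq
  have h1 := hasDerivAt_dt (contDiffOn_comp_logPolar hK) ht θ
  rw [dt_comp_logPolar hK ht] at h1
  refine (hasDerivAt_dt (contDiffOn_cylWeight hK) ht θ).unique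
    ((((hasDerivAt_id t).const_mul (2 + 2 * α)).exp.mul h1).congr_deriv ?_)
  simp only [id_eq]
  ring

theorem dt_cylWeight_le (hK : ContDiffOn ℝ 1 K (closedBall (0 : Plane) 1))
    (hKpos : ∀ y ∈ closedBall (0 : Plane) 1, 0 < K y) {q : ℝ × ℝ} (hq : q ∈ halfCyl) :
    dt (cylWeight K α) q ≤ (2 * (1 + α) +
      (⨆ y : ball (0 : Plane) 1, ‖gradient K ↑y‖) / (⨅ y : ball (0 : Plane) 1, K ↑y)) *
        cylWeight K α q := by
  have hP := (logPolar_mem hq).1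
  have hk := iInf_pos_of_continuousOn hK.continuousOn hKpos
  have hle := iInf_le_of_continuousOn hK.continuousOn hKpos hP
  have hS := le_ciSup (bddAbove_norm_gradient hK) ⟨_, hP⟩
  simp only [norm_gradient_eq] at hS ⊢
  set k := ⨅ y : ball (0 : Plane) 1, K ↑y
  set S := ⨆ y : ball (0 : Plane) 1, ‖fderiv ℝ K ↑y‖
  have hS0 : 0 ≤ S := (norm_nonneg _).trans hS
  have h1 : fderiv ℝ K (logPolar q) (logPolar q) ≤ S / k * K (logPolar q) := by
    calc fderiv ℝ K (logPolar q) (logPolar q)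
        ≤ ‖fderiv ℝ K (logPolar q)‖ * ‖logPolar q‖ :=
          (le_abs_self _).trans ((fderiv ℝ K (logPolar q)).le_opNorm _)
      _ ≤ S * 1 := by
          have := (mem_ball_zero_iff.1 hP).le
          gcongr
      _ = S / k * k := by field_simp
      _ ≤ S / k * K (logPolar q) := by gcongr
  rw [dt_cylWeight (hK.mono (sdiff_subset.trans ball_subset_closedBall)) hq, cylWeight]
  have h2 := mul_le_mul_of_nonneg_left h1 (exp_pos ((2 + 2 * α) * q.1)).le
  linarith

end Weight

theorem logPolar_eq_smul (t θ : ℝ) : logPolar (t, θ) = exp t • logPolar (0, θ) := by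
  ext i
  fin_cases i <;> simp [logPolar]

theorem vanishesAtZero_comp_logPolar {u : Plane → ℝ}
    (hu : ContinuousOn u (closedBall (0 : Plane) 1)) (hbd : ∀ y ∈ sphere (0 : Plane) 1, u y = 0) :
    VanishesAtZero fun q => u (logPolar q) := by
  intro ε hε
  obtain ⟨δ, hδ, h⟩ := Metric.uniformContinuousOn_iff.1
    ((isCompact_closedBall (0 : Plane) 1).uniformContinuousOn_of_continuous hu) ε hε
  refine ⟨-δ, neg_lt_zero.2 hδ, fun t h1 h2 θ => ?_⟩
  have hn : ‖logPolar (0, θ)‖ = 1 := by rw [norm_logPolar, exp_zero]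
  have hs : logPolar (0, θ) ∈ sphere (0 : Plane) 1 := mem_sphere_zero_iff_norm.2 hn
  have hd : dist (logPolar (t, θ)) (logPolar (0, θ)) < δ := by
    have e : logPolar (t, θ) - logPolar (0, θ) = (exp t - 1) • logPolar (0, θ) := by
      rw [logPolar_eq_smul, sub_smul, one_smul]
    rw [dist_eq_norm, e, norm_smul, hn, mul_one, norm_eq_abs, abs_sub_comm,
      abs_of_nonneg (sub_nonneg.2 (exp_le_one_iff.2 h2.le))]
    linarith [add_one_le_exp t]
  have := h _ (ball_subset_closedBall (logPolar_mem (q := (t, θ)) h2).1) _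
    (sphere_subset_closedBall hs) hd
  rw [hbd _ hs, dist_zero_right] at this
  exact this.le

theorem tendsToAtBot_comp_logPolar {u : Plane → ℝ}
    (hu : ContinuousOn u (closedBall (0 : Plane) 1)) :
    TendsToAtBot (fun q => u (logPolar q)) (u 0) := by
  intro ε hε
  obtain ⟨δ, hδ, h⟩ := Metric.continuousOn_iff.1 hu 0 (mem_closedBall_self zero_le_one) ε hε
  refine ⟨min (-1) (log δ), (min_le_left _ _).trans_lt (by norm_num), fun t ht θ => ?_⟩
  have ht0 : t < 0 := (ht.trans_le (min_le_left _ _)).trans (by norm_num)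
  refine (h _ (ball_subset_closedBall (logPolar_mem (q := (t, θ)) ht0).1) ?_).le
  rw [dist_zero_right, norm_logPolar, ← lt_log_iff_exp_lt hδ]
  exact ht.trans_le (min_le_right _ _)

theorem cylWeight_tendsToAtBot {K : Plane → ℝ} {α : ℝ} (hα : -1 < α)
    (hK : ContinuousOn K (closedBall (0 : Plane) 1))
    (hKpos : ∀ y ∈ closedBall (0 : Plane) 1, 0 < K y) : TendsToAtBot (cylWeight K α) 0 := by
  obtain ⟨C, hC, hle⟩ := exists_pos_forall_ge hK hKpos
  have hα2 : 0 < 2 + 2 * α := by linarith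
  intro ε hε
  refine ⟨min (-1) (log (ε / C) / (2 + 2 * α)), (min_le_left _ _).trans_lt (by norm_num),
    fun t ht θ => ?_⟩
  have ht0 : t < 0 := (ht.trans_le (min_le_left _ _)).trans (by norm_num)
  have hP := ball_subset_closedBall (logPolar_mem (q := (t, θ)) ht0).1
  have ht1 := ht.trans_le (min_le_right _ _)
  rw [lt_div_iff₀ hα2, mul_comm, lt_log_iff_exp_lt (by positivity)] at ht1
  rw [sub_zero, cylWeight, abs_of_nonneg (mul_nonneg (exp_pos _).le (hKpos _ hP).le)]
  calc exp ((2 + 2 * α) * t) * K (logPolar (t, θ)) ≤ ε / C * C :=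
        mul_le_mul ht1.le (hle _ hP) (hKpos _ hP).le (by positivity)
    _ = ε := by field_simp

/-- A solution of the Hénon equation on the disk, written in logarithmic polar coordinates. -/
theorem exists_isCylinderSolution {α p C₀ : ℝ} (hα : -1 < α)
    {K : Plane → ℝ} (hK : ContDiffOn ℝ 1 K (closedBall (0 : Plane) 1))
    (hKpos : ∀ y ∈ closedBall (0 : Plane) 1, 0 < K y) {u : Plane → ℝ}
    (hu_cont : ContinuousOn u (closedBall (0 : Plane) 1))
    (hu_C2 : ContDiffOn ℝ 2 u (ball (0 : Plane) 1 \ {0}))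
    (hu_pos : ∀ y ∈ ball (0 : Plane) 1, 0 < u y)
    (heq : ∀ y ∈ ball (0 : Plane) 1 \ {0}, -lap u y = ‖y‖ ^ (2 * α) * K y * u y ^ p)
    (hbd : ∀ y ∈ sphere (0 : Plane) 1, u y = 0) (hsup : ∀ y ∈ ball (0 : Plane) 1, u y ≤ C₀) :
    ∃ C₁, IsCylinderSolution (fun q => u (logPolar q)) (cylWeight K α) p (2 * (1 + α) +
      (⨆ y : ball (0 : Plane) 1, ‖gradient K ↑y‖) / (⨅ y : ball (0 : Plane) 1, K ↑y))
      C₀ C₁ (u 0) := by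
  obtain ⟨C, hC, hle⟩ := exists_pos_forall_ge hK.continuousOn hKpos
  have hmem {q : ℝ × ℝ} (hq : q ∈ halfCyl) := ball_subset_closedBall (logPolar_mem hq).1
  refine ⟨C, ?_⟩
  exact {
    contDiffOn := contDiffOn_comp_logPolar hu_C2
    contDiffOn_weight := contDiffOn_cylWeight (hK.mono (sdiff_subset.trans ball_subset_closedBall))
    periodic := fun t θ => by rw [logPolar_add_two_pi]
    pos := fun q hq => hu_pos _ (logPolar_mem hq).1
    le := fun q hq => hsup _ (logPolar_mem hq).1
    weight_nonneg := fun q hq => mul_nonneg (exp_pos _).le (hKpos _ (hmem hq)).le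
    weight_le := fun q hq => by
      have h1 : exp ((2 + 2 * α) * q.1) ≤ 1 :=
        exp_le_one_iff.2 (mul_nonpos_of_nonneg_of_nonpos (by linarith) (le_of_lt hq))
      exact (mul_le_mul h1 (hle _ (hmem hq)) (hKpos _ (hmem hq)).le zero_le_one).trans_eq
        (one_mul C)
    dt_weight_le := fun q hq => dt_cylWeight_le hK hKpos hq
    laplace_eq := fun q hq => by
      rw [laplace_comp_logPolar hu_C2 hq, cylWeight_eq]
      linear_combination (-exp q.1 ^ 2) * heq _ (logPolar_mem hq)
    vanishes := vanishesAtZero_comp_logPolar hu_cont hbd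
    tendsTo := tendsToAtBot_comp_logPolar hu_cont
    weight_tendsTo := cylWeight_tendsToAtBot hα hK.continuousOn hKpos }

theorem integral_eq_integral_polar (f : Plane → ℝ) :
    ∫ y, f y = ∫ q in Ioi (0 : ℝ) ×ˢ Ioo (-π) π, q.1 * f (logPolar (log q.1, q.2)) := by
  rw [← (PiLp.volume_preserving_toLp (Fin 2)).integral_comp
      (MeasurableEquiv.toLp 2 _).measurableEmbedding,
    ← (volume_preserving_finTwoArrow ℝ).symm.integral_comp', ← integral_comp_polarCoord_symm]
  refine setIntegral_congr_fun (measurableSet_Ioi.prod measurableSet_Ioo) fun q hq => ?_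
  have hq0 : 0 < q.1 := hq.1
  rw [logPolar, exp_log hq0]
  rfl

theorem setIntegral_annulus {f : Plane → ℝ} (hf : ContinuousOn f (ball (0 : Plane) 1 \ {0}))
    {a b : ℝ} (ha : 0 < a) (hab : a ≤ b) (hb : b < 1) :
    ∫ y in {y : Plane | ‖y‖ ∈ Ioc a b}, f y =
      ∫ r in a..b, r * ∫ θ in (-π)..π, f (logPolar (log r, θ)) := by
  have hA : MeasurableSet {y : Plane | ‖y‖ ∈ Ioc a b} := measurable_norm measurableSet_Ioc
  have hcont : ContinuousOn (fun q : ℝ × ℝ => q.1 * f (logPolar (log q.1, q.2)))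
      (Icc a b ×ˢ Icc (-π) π) := by
    refine continuousOn_fst.mul (hf.comp (t := ball (0 : Plane) 1 \ {0})
      (contDiff_logPolar (n := 0).continuous.comp_continuousOn
        ((continuousOn_fst.log fun q hq => (ha.trans_le hq.1.1).ne').prodMk continuousOn_snd))
      fun q hq => logPolar_mem ?_)
    exact log_neg (ha.trans_le hq.1.1) (hq.1.2.trans_lt hb)
  have hint : IntegrableOn (fun q : ℝ × ℝ => q.1 * f (logPolar (log q.1, q.2)))
      (Ioc a b ×ˢ Ioo (-π) π) (volume.prod volume) :=
    (hcont.integrableOn_compact (isCompact_Icc.prod isCompact_Icc)).mono_set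
      (prod_mono Ioc_subset_Icc_self Ioo_subset_Icc_self)
  have hset : (Ioi (0 : ℝ) ×ˢ Ioo (-π) π) ∩ (Ioc a b ×ˢ univ) = Ioc a b ×ˢ Ioo (-π) π := by
    rw [prod_inter_prod, inter_univ, inter_eq_right.2 (Ioc_subset_Ioi_self.trans (Ioi_subset_Ioi ha.le))]
  calc ∫ y in {y : Plane | ‖y‖ ∈ Ioc a b}, f y
      = ∫ q in Ioi (0 : ℝ) ×ˢ Ioo (-π) π, (Ioc a b ×ˢ univ).indicator
          (fun q : ℝ × ℝ => q.1 * f (logPolar (log q.1, q.2))) q := by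
        rw [← integral_indicator hA, integral_eq_integral_polar]
        refine setIntegral_congr_fun (measurableSet_Ioi.prod measurableSet_Ioo) fun q hq => ?_
        have hq0 : 0 < q.1 := hq.1
        simp only [indicator, mem_ofPred_eq, norm_logPolar, exp_log hq0, mem_prod, mem_univ,
          and_true, mul_ite, mul_zero]
    _ = ∫ q in Ioc a b ×ˢ Ioo (-π) π, q.1 * f (logPolar (log q.1, q.2)) := by
        rw [setIntegral_indicator (measurableSet_Ioc.prod MeasurableSet.univ), hset]
    _ = ∫ r in a..b, r * ∫ θ in (-π)..π, f (logPolar (log r, θ)) := by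
        rw [Measure.volume_eq_prod, setIntegral_prod _ hint, intervalIntegral.integral_of_le hab]
        refine setIntegral_congr_fun measurableSet_Ioc fun r _ => ?_
        simp only
        rw [integral_const_mul, intervalIntegral.integral_of_le neg_pi_lt_pi.le,
          integral_Ioc_eq_integral_Ioo]

/-- An upper bound for the integral over the disk follows from a bound over all annuli. -/
theorem setIntegral_ball_le_of_annulus {f : Plane → ℝ} {B : ℝ} (hB : 0 ≤ B)
    (h : ∀ a b, 0 < a → a ≤ b → b < 1 → ∫ y in {y : Plane | ‖y‖ ∈ Ioc a b}, f y ≤ B) :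
    ∫ y in ball (0 : Plane) 1, f y ≤ B := by
  by_cases hf : IntegrableOn f (ball (0 : Plane) 1)
  swap
  · rwa [integral_undef hf]
  set s : ℕ → Set Plane := fun n => {y | ‖y‖ ∈ Ioc (1 / ((n : ℝ) + 1)) (1 - 1 / ((n : ℝ) + 1))}
    with hs
  have hs_mono : Monotone s := fun m n hmn y hy => by
    have := one_div_le_one_div_of_le (by positivity : (0 : ℝ) < m + 1)
      (by gcongr : (m : ℝ) + 1 ≤ n + 1)
    exact ⟨this.trans_lt hy.1, hy.2.trans (by linarith)⟩
  have hU : ⋃ n, s n = ball (0 : Plane) 1 \ {0} := by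
    ext y
    simp only [mem_iUnion, hs, mem_ofPred_eq, mem_sdiff, mem_ball_zero_iff, mem_singleton_iff]
    constructor
    · rintro ⟨n, h1, h2⟩
      have h3 : 0 < 1 / ((n : ℝ) + 1) := by positivity
      exact ⟨by linarith, norm_pos_iff.1 (h3.trans h1)⟩
    · rintro ⟨h1, h2⟩
      obtain ⟨n, hn⟩ := exists_nat_one_div_lt (lt_min (norm_pos_iff.2 h2) (sub_pos.2 h1))
      have h3 := hn.trans_le (min_le_left _ _)
      have h4 := hn.trans_le (min_le_right _ _)
      exact ⟨n, h3, by linarith⟩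
  have hlim := tendsto_setIntegral_of_monotone (f := f) (μ := volume) (s := s)
    (fun n => measurable_norm measurableSet_Ioc) hs_mono (by
      rw [hU]
      exact hf.mono_set sdiff_subset)
  rw [hU, setIntegral_congr_set (sdiff_null_ae_eq_self (measure_singleton (0 : Plane)))] at hlim
  refine le_of_tendsto hlim ?_
  filter_upwards [Filter.eventually_ge_atTop 1] with n hn
  have hn' : (1 : ℝ) ≤ n := by exact_mod_cast hn
  have h3 : 0 < 1 / ((n : ℝ) + 1) := by positivity
  have h4 : 1 / ((n : ℝ) + 1) ≤ 1 / 2 := one_div_le_one_div_of_le two_pos (by linarith)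
  exact h _ _ h3 (by linarith) (by linarith)

/-- The mass of the source over an annulus is the increment of the flux. -/
theorem IsCylinderSolution.setIntegral_annulus_le {α p M C₀ C₁ L : ℝ} {K u : Plane → ℝ}
    (S : IsCylinderSolution (fun q => u (logPolar q)) (cylWeight K α) p M C₀ C₁ L) (hp : 0 < p)
    (hM : 0 ≤ M)
    (hf : ContinuousOn (fun y => ‖y‖ ^ (2 * α) * K y * u y ^ p) (ball (0 : Plane) 1 \ {0}))
    {a b : ℝ} (ha : 0 < a) (hab : a ≤ b) (hb : b < 1) :
    ∫ y in {y : Plane | ‖y‖ ∈ Ioc a b}, ‖y‖ ^ (2 * α) * K y * u y ^ p ≤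
      4 * π * (M * C₀ / (p + 1)) := by
  have hlog {r : ℝ} (hr : r ∈ Icc a b) : log r < 0 :=
    log_neg (ha.trans_le hr.1) (hr.2.trans_lt hb)
  set X : ℝ → ℝ := fun r => -∫ θ in (-π)..π, dt (fun q => u (logPolar q)) (log r, θ) with hX
  have hder : ∀ r ∈ Icc a b, HasDerivAt X (r * ∫ θ in (-π)..π, ‖logPolar (log r, θ)‖ ^ (2 * α) *
      K (logPolar (log r, θ)) * u (logPolar (log r, θ)) ^ p) r := by
    intro r hr
    have hr0 : 0 < r := ha.trans_le hr.1
    refine ((S.hasDerivAt_flux (hlog hr)).comp r (hasDerivAt_log hr0.ne')).neg.congr_deriv ?_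
    simp only [cylWeight_eq, exp_log hr0, mul_assoc]
    rw [intervalIntegral.integral_const_mul]
    field_simp
  have hnonneg : ∀ r ∈ Icc a b, 0 ≤ r * ∫ θ in (-π)..π, ‖logPolar (log r, θ)‖ ^ (2 * α) *
      K (logPolar (log r, θ)) * u (logPolar (log r, θ)) ^ p := by
    intro r hr
    have hr0 : 0 < r := ha.trans_le hr.1
    refine mul_nonneg hr0.le (intervalIntegral.integral_nonneg neg_pi_lt_pi.le fun θ _ => ?_)
    have h := S.source_nonneg (q := (log r, θ)) (hlog hr)
    simp only [cylWeight_eq, mul_assoc] at h ⊢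
    exact nonneg_of_mul_nonneg_right h (by positivity)
  rw [setIntegral_annulus hf ha hab hb, intervalIntegral.integral_eq_sub_of_hasDerivAt (f := X)
    (by rwa [uIcc_of_le hab])]
  · have h1 := S.flux_nonpos (hlog (left_mem_Icc.2 hab))
    have h2 := S.neg_flux_le hp hM (hlog (right_mem_Icc.2 hab))
    simp only [hX]
    linarith
  · refine intervalIntegral.intervalIntegrable_deriv_of_nonneg (g := X) ?_ ?_ ?_
    · rw [uIcc_of_le hab]
      exact fun r hr => (hder r hr).continuousAt.continuousWithinAt
    · rw [min_eq_left hab, max_eq_right hab]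
      exact fun r hr => hder r (Ioo_subset_Icc_self hr)
    · rw [min_eq_left hab, max_eq_right hab]
      exact fun r hr => hnonneg r (Ioo_subset_Icc_self hr)

/-- Explicit mass bound for the Hénon–Lane–Emden problem on the unit disk, given an a
priori `L^∞` bound `C₀` on the solution. -/
theorem mass_bound_henon_disk (α p C₀ : ℝ) (hα : -1 < α) (hp : 1 < p) (hC₀ : 0 < C₀)
    (K : Plane → ℝ) (hK : ContDiffOn ℝ 1 K (closedBall (0 : Plane) 1))
    (hKpos : ∀ y ∈ closedBall (0 : Plane) 1, 0 < K y)
    (u : Plane → ℝ)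
    (hu_cont : ContinuousOn u (closedBall (0 : Plane) 1))
    (hu_C2 : ContDiffOn ℝ 2 u (ball (0 : Plane) 1 \ {0}))
    (hu_pos : ∀ y ∈ ball (0 : Plane) 1, 0 < u y)
    (heq : ∀ y ∈ ball (0 : Plane) 1 \ {0},
      -lap u y = ‖y‖ ^ (2 * α) * K y * u y ^ p)
    (hbd : ∀ y ∈ sphere (0 : Plane) 1, u y = 0)
    (hsup : ∀ y ∈ ball (0 : Plane) 1, u y ≤ C₀) :
    p * ∫ y in ball (0 : Plane) 1, ‖y‖ ^ (2 * α) * K y * u y ^ (p + 1) ≤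
      8 * π * C₀ ^ 2 * (2 * (1 + α) +
        (⨆ y : ball (0 : Plane) 1, ‖gradient K ↑y‖) / (⨅ y : ball (0 : Plane) 1, K ↑y)) := by
  set M := 2 * (1 + α) +
    (⨆ y : ball (0 : Plane) 1, ‖gradient K ↑y‖) / (⨅ y : ball (0 : Plane) 1, K ↑y) with hM
  have hp0 : 0 < p := by linarith
  have hpi := pi_pos
  have hM0 : 0 ≤ M := by
    have h1 := iInf_pos_of_continuousOn hK.continuousOn hKpos
    have h2 : 0 ≤ ⨆ y : ball (0 : Plane) 1, ‖gradient K ↑y‖ :=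
      Real.iSup_nonneg fun _ => norm_nonneg _
    have h3 : 0 < 1 + α := by linarith
    positivity
  obtain ⟨C₁, S⟩ := exists_isCylinderSolution hα hK hKpos hu_cont hu_C2 hu_pos heq hbd hsup
  have hcont (s : ℝ) : ContinuousOn (fun y => ‖y‖ ^ (2 * α) * K y * u y ^ s)
      (ball (0 : Plane) 1 \ {0}) :=
    ((continuousOn_id.norm.rpow_const fun y hy => Or.inl (norm_ne_zero_iff.2 hy.2)).mul
      (hK.continuousOn.mono (sdiff_subset.trans ball_subset_closedBall))).mul
      (hu_C2.continuousOn.rpow_const fun y hy => Or.inl (hu_pos y hy.1).ne')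
  have hann (s : ℝ) {a b : ℝ} (ha : 0 < a) (hb : b < 1) :
      IntegrableOn (fun y : Plane => ‖y‖ ^ (2 * α) * K y * u y ^ s) {y | ‖y‖ ∈ Ioc a b} := by
    have hcomp : IsCompact {y : Plane | ‖y‖ ∈ Icc a b} :=
      (isCompact_closedBall (0 : Plane) b).of_isClosed_subset
        (isClosed_Icc.preimage continuous_norm) fun y hy => mem_closedBall_zero_iff.2 hy.2
    refine (((hcont s).mono fun y hy => ⟨?_, ?_⟩).integrableOn_compact hcomp).mono_set
      fun y hy => Ioc_subset_Icc_self hy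
    · exact mem_ball_zero_iff.2 (hy.2.trans_lt hb)
    · exact norm_pos_iff.1 (ha.trans_le hy.1)
  have hJ : ∫ y in ball (0 : Plane) 1, ‖y‖ ^ (2 * α) * K y * u y ^ (p + 1) ≤
      C₀ * (4 * π * (M * C₀ / (p + 1))) := by
    refine setIntegral_ball_le_of_annulus (by positivity) fun a b ha hab hb => ?_
    refine le_trans ?_ (mul_le_mul_of_nonneg_left
      (S.setIntegral_annulus_le hp0 hM0 (hcont p) ha hab hb) hC₀.le)
    rw [← integral_const_mul]
    refine setIntegral_mono_on (hann _ ha hb) ((hann p ha hb).const_mul C₀)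
      (measurable_norm measurableSet_Ioc) fun y hy => ?_
    have hyb : y ∈ ball (0 : Plane) 1 := mem_ball_zero_iff.2 (hy.2.trans_lt hb)
    have hu0 := hu_pos y hyb
    have hK0 := hKpos y (ball_subset_closedBall hyb)
    rw [rpow_add_one hu0.ne', ← mul_assoc, mul_comm C₀]
    exact mul_le_mul_of_nonneg_left (hsup y hyb) (by positivity)
  calc p * ∫ y in ball (0 : Plane) 1, ‖y‖ ^ (2 * α) * K y * u y ^ (p + 1)
      ≤ p * (C₀ * (4 * π * (M * C₀ / (p + 1)))) := mul_le_mul_of_nonneg_left hJ hp0.le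
    _ = p / (p + 1) * (4 * π * C₀ ^ 2 * M) := by ring
    _ ≤ 1 * (4 * π * C₀ ^ 2 * M) := by
        refine mul_le_mul_of_nonneg_right ?_ (by positivity)
        rw [div_le_one (by linarith)]
        linarith
    _ ≤ 8 * π * C₀ ^ 2 * M := by
        have : 0 ≤ π * C₀ ^ 2 * M := by positivity
        linarith
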